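/- arXiv:2507.03551 — 5 statements merged into one kernel-verified Lean document; each statement's English description precedes it below -/
import Mathlib

section
/- Let (a,b) satisfy 0 < b < a and a > 1. Then for every x > 0, x·(d/dx) log M_{a,b}(x) = 2 ∫₀^∞ η_{a,b}(t)/(x+t)³ dt; in particular the function x ↦ x·(log M_{a,b})'(x) belongs to the generalized Stieltjes class S_3. -/
open MeasureTheory Real Set

/-- `M_{a,b}(x) = x^{a-b} Γ(x+b)/Γ(x+a)`. -/
noncomputable def M (a b : ℝ) (x : ℝ) : ℝ :=
  x ^ (a - b) * Real.Gamma (x + b) / Real.Gamma (x + a)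

/-- `η_{a,b}(s) = Σ_{k=0}^∞ ((b+k) max(s-k-b,0) - (a+k) max(s-k-a,0))`. -/
noncomputable def eta (a b : ℝ) (s : ℝ) : ℝ :=
  ∑' k : ℕ, ((b + k) * max (s - k - b) 0 - (a + k) * max (s - k - a) 0)

/-- `g` is a generalized Stieltjes function of order `lam`. -/
def IsGenStieltjes (lam : ℝ) (g : ℝ → ℝ) : Prop :=
  ∃ (μ : MeasureTheory.Measure ℝ) (c : ℝ),
    μ (Set.Iio 0) = 0 ∧ 0 ≤ c ∧
    ∀ x : ℝ, 0 < x →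
      MeasureTheory.Integrable (fun t => (x + t) ^ (-lam)) μ ∧
      g x = (∫ t, (x + t) ^ (-lam) ∂μ) + c

/-- The logarithmic derivative of the Gamma function on `(0, ∞)`. -/
noncomputable def derivLogGamma (y : ℝ) : ℝ := deriv (Real.log ∘ Real.Gamma) y

lemma differentiableAt_log_Gamma {y : ℝ} (hy : 0 < y) :
    DifferentiableAt ℝ (Real.log ∘ Real.Gamma) y := by
  have h : DifferentiableAt ℝ Real.Gamma y := by
    refine Real.differentiableAt_Gamma fun m hm => ?_
    have : (0 : ℝ) ≤ m := m.cast_nonneg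
    linarith
  exact h.log (Real.Gamma_pos_of_pos hy).ne'

lemma hasDerivAt_log_Gamma {y : ℝ} (hy : 0 < y) :
    HasDerivAt (Real.log ∘ Real.Gamma) (derivLogGamma y) y :=
  (differentiableAt_log_Gamma hy).hasDerivAt

lemma monotoneOn_derivLogGamma : MonotoneOn derivLogGamma (Ioi 0) :=
  Real.convexOn_log_Gamma.monotoneOn_deriv fun _ hx => differentiableAt_log_Gamma hx

lemma derivLogGamma_add_one {y : ℝ} (hy : 0 < y) :
    derivLogGamma (y + 1) = derivLogGamma y + 1 / y := by
  have h1 : HasDerivAt (fun z => (Real.log ∘ Real.Gamma) (z + 1)) (derivLogGamma (y + 1)) y :=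
    (hasDerivAt_log_Gamma (by linarith : 0 < y + 1)).comp_add_const y 1
  have h2 : HasDerivAt (fun z => (Real.log ∘ Real.Gamma) z + Real.log z)
      (derivLogGamma y + 1 / y) y := by
    rw [one_div]
    exact (hasDerivAt_log_Gamma hy).add (Real.hasDerivAt_log hy.ne')
  refine h1.unique (h2.congr_of_eventuallyEq ?_)
  filter_upwards [lt_mem_nhds hy] with z hz
  simp only [Function.comp_apply]
  rw [Real.Gamma_add_one hz.ne', Real.log_mul hz.ne' (Real.Gamma_pos_of_pos hz).ne', add_comm]

lemma derivLogGamma_add_nat {y : ℝ} (hy : 0 < y) (N : ℕ) :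
    derivLogGamma (y + N) = derivLogGamma y + ∑ k ∈ Finset.range N, 1 / (y + k) := by
  induction N with
  | zero => simp
  | succ n ih =>
    rw [Finset.sum_range_succ, ← add_assoc, ← ih, Nat.cast_succ, ← add_assoc,
      derivLogGamma_add_one (by positivity)]

lemma tendsto_derivLogGamma_add_nat_sub {y z : ℝ} (hy : 0 < y) (hyz : y ≤ z) (hz : z ≤ y + 1) :
    Filter.Tendsto (fun N : ℕ => derivLogGamma (z + N) - derivLogGamma (y + N))
      Filter.atTop (nhds 0) := by
  have hlim : Filter.Tendsto (fun N : ℕ => 1 / (y + (N : ℝ))) Filter.atTop (nhds 0) := by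
    simp only [one_div]
    exact tendsto_inv_atTop_zero.comp
      (Filter.tendsto_atTop_add_const_left _ _ tendsto_natCast_atTop_atTop)
  refine squeeze_zero (fun N => ?_) (fun N => ?_) hlim
  · exact sub_nonneg.2 (monotoneOn_derivLogGamma (mem_Ioi.2 (by positivity))
      (mem_Ioi.2 (by have : (0 : ℝ) ≤ N := N.cast_nonneg
                     linarith)) (by linarith))
  · have hN : 0 < y + (N : ℝ) := by positivity
    have := monotoneOn_derivLogGamma (mem_Ioi.2 (by linarith : 0 < z + (N : ℝ)))
      (mem_Ioi.2 (by linarith : 0 < y + (N : ℝ) + 1)) (by linarith)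
    rw [derivLogGamma_add_one hN] at this
    linarith

lemma mul_deriv_log_M {a b x : ℝ} (ha : 0 < a) (hb : 0 < b) (hx : 0 < x) :
    x * deriv (fun y => Real.log (M a b y)) x
      = (a - b) + x * (derivLogGamma (x + b) - derivLogGamma (x + a)) := by
  have h : HasDerivAt (fun y => (a - b) * Real.log y + (Real.log ∘ Real.Gamma) (y + b)
      - (Real.log ∘ Real.Gamma) (y + a))
      ((a - b) * x⁻¹ + derivLogGamma (x + b) - derivLogGamma (x + a)) x :=
    (((Real.hasDerivAt_log hx.ne').const_mul (a - b)).add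
      ((hasDerivAt_log_Gamma (by linarith : 0 < x + b)).comp_add_const x b)).sub
      ((hasDerivAt_log_Gamma (by linarith : 0 < x + a)).comp_add_const x a)
  have heq : (fun y => Real.log (M a b y)) =ᶠ[nhds x]
      (fun y => (a - b) * Real.log y + (Real.log ∘ Real.Gamma) (y + b)
        - (Real.log ∘ Real.Gamma) (y + a)) := by
    filter_upwards [lt_mem_nhds hx] with y hy
    have hyb := (Real.Gamma_pos_of_pos (by linarith : 0 < y + b)).ne'
    have hya := (Real.Gamma_pos_of_pos (by linarith : 0 < y + a)).ne'
    have hyp := (Real.rpow_pos_of_pos hy (a - b)).ne'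
    simp only [M, Function.comp_apply]
    rw [Real.log_div (mul_ne_zero hyp hyb) hya, Real.log_mul hyp hyb, Real.log_rpow hy]
  rw [heq.deriv_eq, h.deriv]
  field_simp
  ring

lemma eta_eq_sum {a b t : ℝ} (hba : b ≤ a) {N : ℕ} (ht : t ≤ b + N) :
    eta a b t = ∑ k ∈ Finset.range N,
      ((b + k) * max (t - k - b) 0 - (a + k) * max (t - k - a) 0) := by
  refine tsum_eq_sum fun k hk => ?_
  have hk' : (N : ℝ) ≤ k := by exact_mod_cast not_lt.1 (mt Finset.mem_range.2 hk)
  rw [max_eq_right (by linarith), max_eq_right (by linarith)]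
  simp

lemma eta_add_eta {a b c : ℝ} (hb : 0 < b) (hbc : b ≤ c) (hca : c ≤ a) (t : ℝ) :
    eta a c t + eta c b t = eta a b t := by
  have hN := Nat.le_ceil t
  rw [eta_eq_sum hca (N := ⌈t⌉₊) (by linarith), eta_eq_sum hbc (N := ⌈t⌉₊) (by linarith),
    eta_eq_sum (hbc.trans hca) (N := ⌈t⌉₊) (by linarith), ← Finset.sum_add_distrib]
  exact Finset.sum_congr rfl fun k _ => by ring

lemma measurable_eta {a b : ℝ} (hb : 0 < b) (hba : b ≤ a) : Measurable (eta a b) := by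
  refine measurable_of_tendsto_metrizable (f := fun (N : ℕ) t => ∑ k ∈ Finset.range N,
      ((b + k) * max (t - k - b) 0 - (a + k) * max (t - k - a) 0)) (fun N => ?_) ?_
  · fun_prop
  · rw [tendsto_pi_nhds]
    intro t
    refine tendsto_const_nhds.congr' ?_
    filter_upwards [Filter.eventually_ge_atTop ⌈t⌉₊] with N hN
    exact eta_eq_sum hba (by linarith [Nat.ceil_le.1 hN])

lemma sum_range_quadratic_sub (a b t : ℝ) (n : ℕ) :
    ∑ k ∈ Finset.range n, ((b + k) * (t - k - b) - (a + k) * (t - k - a))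
      = (a - b) * n * (a + b + n - 1 - t) := by
  induction n with
  | zero => simp
  | succ n ih =>
    rw [Finset.sum_range_succ, ih]
    push_cast
    ring

lemma eta_nonneg_of_le_add_one {a b : ℝ} (hb : 0 < b) (hba : b < a) (hab : a ≤ b + 1)
    (ha : 1 < a) (t : ℝ) : 0 ≤ eta a b t := by
  rcases lt_or_ge t a with hta | hta
  · refine tsum_nonneg fun k => ?_
    have hk : (0 : ℝ) ≤ k := k.cast_nonneg
    rw [max_eq_right (by linarith : t - k - a ≤ 0), mul_zero, sub_zero]
    positivity
  · set m := ⌊t - a⌋₊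
    have h1 : (m : ℝ) ≤ t - a := Nat.floor_le (by linarith)
    have h2 : t - a < m + 1 := Nat.lt_floor_add_one _
    have hm : (0 : ℝ) ≤ m := m.cast_nonneg
    have hsum : ∑ k ∈ Finset.range (m + 1),
        ((b + k) * max (t - k - b) 0 - (a + k) * max (t - k - a) 0)
        = (a - b) * (m + 1) * (a + b + m - t) := by
      rw [Finset.sum_congr rfl (g := fun k : ℕ => (b + k) * (t - k - b) - (a + k) * (t - k - a)),
        sum_range_quadratic_sub]
      · push_cast
        ring
      · intro k hk
        have hk' : (k : ℝ) ≤ m := by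
          exact_mod_cast Nat.lt_succ_iff.1 (Finset.mem_range.1 hk)
        rw [max_eq_left (by linarith), max_eq_left (by linarith)]
    rw [eta_eq_sum hba.le (N := m + 1 + 1) (by push_cast; linarith), Finset.sum_range_succ, hsum]
    push_cast
    rw [max_eq_right (by linarith : t - (m + 1) - a ≤ 0), mul_zero, sub_zero]
    have hd : 0 < a - b := by linarith
    rcases le_total (t - (m + 1) - b) 0 with h | h
    · rw [max_eq_right h, mul_zero, add_zero]
      exact mul_nonneg (by positivity) (by linarith)
    · rw [max_eq_left h]
      have h3 : 0 ≤ (a + m + 1 - t) * ((m + 1) * (a - 1)) :=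
        mul_nonneg (by linarith) (mul_nonneg (by positivity) (by linarith))
      have h4 : 0 ≤ (t - (m + 1) - b) * (b * (m + 2)) := mul_nonneg h (by positivity)
      linarith

lemma integral_max_sub_div_cube {x u T : ℝ} (hx : 0 < x) (hu : 0 ≤ u) (huT : u ≤ T) :
    ∫ t in (0 : ℝ)..T, max (t - u) 0 / (x + t) ^ 3
      = (T - u) ^ 2 / (2 * (x + u) * (x + T) ^ 2) := by
  have hne : ∀ t, 0 ≤ t → x + t ≠ 0 := fun t ht => by positivity
  have hcont : ∀ p q : ℝ, 0 ≤ p → p ≤ q →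
      IntervalIntegrable (fun t => max (t - u) 0 / (x + t) ^ 3) volume p q := by
    intro p q hp hpq
    refine ContinuousOn.intervalIntegrable ?_
    refine ContinuousOn.div (by fun_prop) (by fun_prop) fun t ht => ?_
    rw [uIcc_of_le hpq] at ht
    exact pow_ne_zero _ (hne t (hp.trans ht.1))
  rw [← intervalIntegral.integral_add_adjacent_intervals (hcont 0 u le_rfl hu) (hcont u T hu huT)]
  have h0 : ∫ t in (0 : ℝ)..u, max (t - u) 0 / (x + t) ^ 3 = 0 := by
    rw [intervalIntegral.integral_congr (g := fun _ => 0)]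
    · simp
    · intro t ht
      rw [uIcc_of_le hu] at ht
      simp [max_eq_right (sub_nonpos.2 ht.2)]
  have h1 : ∫ t in u..T, max (t - u) 0 / (x + t) ^ 3
      = (T - u) ^ 2 / (2 * (x + u) * (x + T) ^ 2) - (u - u) ^ 2 / (2 * (x + u) * (x + u) ^ 2) := by
    refine intervalIntegral.integral_eq_sub_of_hasDerivAt
      (f := fun t => (t - u) ^ 2 / (2 * (x + u) * (x + t) ^ 2)) (fun t ht => ?_) (hcont u T hu huT)
    rw [uIcc_of_le huT] at ht
    have hxu := hne u hu
    have hxt := hne t (hu.trans ht.1)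
    have hnum : HasDerivAt (fun t => (t - u) ^ 2) (2 * (t - u)) t := by
      simpa using ((hasDerivAt_id t).sub_const u).fun_pow 2
    have hden : HasDerivAt (fun t => 2 * (x + u) * (x + t) ^ 2)
        (2 * (x + u) * (2 * (x + t))) t := by
      simpa using (((hasDerivAt_id t).const_add x).fun_pow 2).const_mul (2 * (x + u))
    refine (hnum.div hden (by positivity)).congr_deriv ?_
    rw [max_eq_left (sub_nonneg.2 ht.1)]
    field_simp
    ring
  rw [h0, h1]
  simp

lemma intervalIntegrable_mul_max_div_cube {x T : ℝ} (hx : 0 < x) (hT : 0 ≤ T) (c u : ℝ) :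
    IntervalIntegrable (fun t => c * (max (t - u) 0 / (x + t) ^ 3)) volume 0 T := by
  refine ContinuousOn.intervalIntegrable ?_
  refine ContinuousOn.mul (by fun_prop) (ContinuousOn.div (by fun_prop) (by fun_prop) ?_)
  intro t ht
  rw [uIcc_of_le hT] at ht
  have := ht.1
  positivity

lemma eta_div_cube_eqOn {a b x : ℝ} (hb : 0 < b) (hba : b ≤ a) (N : ℕ) :
    EqOn (fun t => eta a b t / (x + t) ^ 3) (fun t => ∑ k ∈ Finset.range N,
      ((b + k) * (max (t - (b + k)) 0 / (x + t) ^ 3)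
        - (a + k) * (max (t - (a + k)) 0 / (x + t) ^ 3))) (uIcc 0 (b + N)) := by
  intro t ht
  rw [uIcc_of_le (by positivity)] at ht
  simp only [eta_eq_sum hba ht.2, Finset.sum_div]
  refine Finset.sum_congr rfl fun k _ => ?_
  rw [sub_sub t, sub_sub t, add_comm (k : ℝ) b, add_comm (k : ℝ) a]
  ring

lemma intervalIntegrable_eta_div_cube {a b x : ℝ} (hb : 0 < b) (hba : b ≤ a) (hx : 0 < x)
    (N : ℕ) : IntervalIntegrable (fun t => eta a b t / (x + t) ^ 3) volume 0 (b + N) := by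
  have hT : (0 : ℝ) ≤ b + N := by positivity
  refine IntervalIntegrable.congr
    (fun t ht => (eta_div_cube_eqOn hb hba N (uIoc_subset_uIcc ht)).symm) ?_
  have := IntervalIntegrable.sum (μ := volume) (a := 0) (b := b + N) (Finset.range N)
    (f := fun k t => (b + k) * (max (t - (b + k)) 0 / (x + t) ^ 3)
        - (a + k) * (max (t - (a + k)) 0 / (x + t) ^ 3)) fun k _ =>
      (intervalIntegrable_mul_max_div_cube hx hT _ _).sub
        (intervalIntegrable_mul_max_div_cube hx hT _ _)
  rwa [Finset.sum_fn] at this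

lemma sum_range_linear (a b x T : ℝ) (N : ℕ) :
    ∑ k ∈ Finset.range N, (a - b) * (2 * T + x - 2 * k - a - b)
      = (a - b) * (N * (2 * T + x - a - b) - N * (N - 1)) := by
  induction N with
  | zero => simp
  | succ n ih =>
    rw [Finset.sum_range_succ, ih]
    push_cast
    ring

lemma two_mul_integral_eta_div_cube {a b x : ℝ} (hb : 0 < b) (hba : b < a) (hab : a ≤ b + 1)
    (hx : 0 < x) (N : ℕ) :
    2 * ∫ t in (0 : ℝ)..(b + N), eta a b t / (x + t) ^ 3
      = (a - b) * (N * (N + (x + b + 1 - a))) / (x + b + N) ^ 2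
        + x * ((derivLogGamma (x + b) - derivLogGamma (x + a))
          + (derivLogGamma (x + a + N) - derivLogGamma (x + b + N))) := by
  have hT : (0 : ℝ) ≤ b + N := by positivity
  have hxT : x + b + N ≠ 0 := by positivity
  rw [intervalIntegral.integral_congr (eta_div_cube_eqOn hb hba.le N),
    intervalIntegral.integral_finsetSum fun k _ =>
      (intervalIntegrable_mul_max_div_cube hx hT _ _).sub
        (intervalIntegrable_mul_max_div_cube hx hT _ _), Finset.mul_sum]
  have hterm : ∀ k ∈ Finset.range N,
      2 * ∫ t in (0 : ℝ)..(b + N), ((b + k) * (max (t - (b + k)) 0 / (x + t) ^ 3)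
        - (a + k) * (max (t - (a + k)) 0 / (x + t) ^ 3))
      = (a - b) * (2 * (b + N) + x - 2 * k - a - b) / (x + b + N) ^ 2
        + x * (1 / (x + a + k) - 1 / (x + b + k)) := by
    intro k hk
    have hk1 : (k : ℝ) + 1 ≤ N := by exact_mod_cast Finset.mem_range.1 hk
    have hk0 : (0 : ℝ) ≤ k := k.cast_nonneg
    have ha : 0 < a := hb.trans hba
    rw [intervalIntegral.integral_sub (intervalIntegrable_mul_max_div_cube hx hT _ _)
        (intervalIntegrable_mul_max_div_cube hx hT _ _), intervalIntegral.integral_const_mul,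
      intervalIntegral.integral_const_mul,
      integral_max_sub_div_cube hx (by positivity) (by linarith),
      integral_max_sub_div_cube hx (by positivity) (by linarith)]
    have h1 : x + a + k ≠ 0 := by positivity
    have h2 : x + b + k ≠ 0 := by positivity
    simp only [← add_assoc]
    field_simp
    ring
  rw [Finset.sum_congr rfl hterm, Finset.sum_add_distrib, ← Finset.sum_div, sum_range_linear,
    ← Finset.mul_sum, Finset.sum_sub_distrib, derivLogGamma_add_nat (by linarith),
    derivLogGamma_add_nat (by linarith)]
  ring

lemma tendsto_two_mul_integral_eta_div_cube {a b x : ℝ} (hb : 0 < b) (hba : b < a)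
    (hab : a ≤ b + 1) (hx : 0 < x) :
    Filter.Tendsto (fun N : ℕ => 2 * ∫ t in (0 : ℝ)..(b + N), eta a b t / (x + t) ^ 3)
      Filter.atTop
      (nhds ((a - b) + x * (derivLogGamma (x + b) - derivLogGamma (x + a)))) := by
  have hratio : ∀ c : ℝ, Filter.Tendsto (fun N : ℕ => ((N : ℝ) + c) / (x + b + N))
      Filter.atTop (nhds 1) := by
    intro c
    have h : Filter.Tendsto (fun N : ℕ => 1 + (c - x - b) * (x + b + (N : ℝ))⁻¹)
        Filter.atTop (nhds (1 + (c - x - b) * 0)) :=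
      ((tendsto_inv_atTop_zero.comp (Filter.tendsto_atTop_add_const_left _ (x + b)
        tendsto_natCast_atTop_atTop)).const_mul _).const_add _
    rw [mul_zero, add_zero] at h
    refine h.congr fun N => ?_
    have : x + b + (N : ℝ) ≠ 0 := by positivity
    field_simp
    ring
  have h1 := ((hratio 0).mul (hratio (x + b + 1 - a))).const_mul (a - b)
  have h2 := ((tendsto_derivLogGamma_add_nat_sub (y := x + b) (z := x + a) (by linarith)
    (by linarith) (by linarith)).const_add
      (derivLogGamma (x + b) - derivLogGamma (x + a))).const_mul x
  have h := h1.add h2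
  rw [mul_one, mul_one, add_zero] at h
  refine h.congr fun N => ?_
  rw [two_mul_integral_eta_div_cube hb hba hab hx, add_zero, div_mul_div_comm, sq,
    mul_div_assoc (a - b)]

lemma tendsto_const_add_natCast_atTop (b : ℝ) :
    Filter.Tendsto (fun N : ℕ => b + (N : ℝ)) Filter.atTop Filter.atTop :=
  Filter.tendsto_atTop_add_const_left _ _ tendsto_natCast_atTop_atTop

lemma integrableOn_eta_and_two_mul_integral_of_le_add_one {a b x : ℝ} (hb : 0 < b) (hba : b < a)
    (hab : a ≤ b + 1) (ha : 1 < a) (hx : 0 < x) :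
    IntegrableOn (fun t => eta a b t / (x + t) ^ 3) (Ioi 0) ∧
    2 * ∫ t in Ioi (0 : ℝ), eta a b t / (x + t) ^ 3
      = (a - b) + x * (derivLogGamma (x + b) - derivLogGamma (x + a)) := by
  have hlim := tendsto_two_mul_integral_eta_div_cube hb hba hab hx
  have hint : IntegrableOn (fun t => eta a b t / (x + t) ^ 3) (Ioi 0) := by
    refine integrableOn_Ioi_of_intervalIntegral_norm_tendsto
      (b := fun N : ℕ => b + (N : ℝ)) (l := Filter.atTop) _ 0 (fun N => ?_)
      (tendsto_const_add_natCast_atTop b) ((hlim.const_mul (1 / 2)).congr fun N => ?_)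
    · exact (intervalIntegrable_iff_integrableOn_Ioc_of_le (by positivity)).1
        (intervalIntegrable_eta_div_cube hb hba.le hx N)
    · rw [← mul_assoc, one_div, inv_mul_cancel₀ two_ne_zero, one_mul]
      refine intervalIntegral.integral_congr fun t ht => ?_
      rw [uIcc_of_le (by positivity)] at ht
      have ht0 := ht.1
      exact (Real.norm_of_nonneg
        (div_nonneg (eta_nonneg_of_le_add_one hb hba hab ha t) (by positivity))).symm
  exact ⟨hint, tendsto_nhds_unique ((intervalIntegral_tendsto_integral_Ioi 0 hint
    (tendsto_const_add_natCast_atTop b)).const_mul 2) hlim⟩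

lemma eta_nonneg_and_integrableOn_and_two_mul_integral {a b : ℝ} (hb : 0 < b) (hba : b < a)
    (ha : 1 < a) :
    (∀ t, 0 ≤ eta a b t) ∧ ∀ x, 0 < x →
      IntegrableOn (fun t => eta a b t / (x + t) ^ 3) (Ioi 0) ∧
      2 * ∫ t in Ioi (0 : ℝ), eta a b t / (x + t) ^ 3
        = (a - b) + x * (derivLogGamma (x + b) - derivLogGamma (x + a)) := by
  obtain ⟨n, hn⟩ := exists_nat_ge (a - b)
  induction n generalizing b with
  | zero =>
    rw [Nat.cast_zero] at hn
    linarith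
  | succ n ih =>
    rcases le_or_gt a (b + 1) with hab | hab
    · exact ⟨eta_nonneg_of_le_add_one hb hba hab ha, fun x hx =>
        integrableOn_eta_and_two_mul_integral_of_le_add_one hb hba hab ha hx⟩
    · push_cast at hn
      obtain ⟨hnonneg, hrepr⟩ := ih (b := b + 1) (by linarith) hab (by linarith)
      have hb1 : b < b + 1 := by linarith
      have hadd := eta_add_eta hb hb1.le hab.le
      refine ⟨fun t => ?_, fun x hx => ?_⟩
      · rw [← hadd t]
        exact add_nonneg (hnonneg t)
          (eta_nonneg_of_le_add_one hb hb1 le_rfl (by linarith) t)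
      · obtain ⟨hi1, he1⟩ := hrepr x hx
        obtain ⟨hi2, he2⟩ := integrableOn_eta_and_two_mul_integral_of_le_add_one hb hb1 le_rfl
          (by linarith) hx
        simp only [← hadd, add_div]
        refine ⟨hi1.add hi2, ?_⟩
        rw [integral_add hi1 hi2, mul_add, he1, he2]
        ring

theorem x_mul_deriv_log_M_repr_and_isGenStieltjes_three (a b : ℝ)
    (hb : 0 < b) (hba : b < a) (ha : 1 < a) :
    (∀ x : ℝ, 0 < x →
      x * deriv (fun y => Real.log (M a b y)) x
        = 2 * ∫ t in Set.Ioi (0 : ℝ), eta a b t / (x + t) ^ 3) ∧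
    IsGenStieltjes 3 (fun x => x * deriv (fun y => Real.log (M a b y)) x) := by
  obtain ⟨hnonneg, hrepr⟩ := eta_nonneg_and_integrableOn_and_two_mul_integral hb hba ha
  have hmain : ∀ x : ℝ, 0 < x → x * deriv (fun y => Real.log (M a b y)) x
      = 2 * ∫ t in Set.Ioi (0 : ℝ), eta a b t / (x + t) ^ 3 := fun x hx => by
    rw [mul_deriv_log_M (hb.trans hba) hb hx, (hrepr x hx).2]
  refine ⟨hmain, ?_⟩
  have hmeas : Measurable fun t => ENNReal.ofReal (2 * eta a b t) :=
    ((measurable_eta hb hba.le).const_mul 2).ennreal_ofReal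
  have hfin : ∀ᵐ t ∂(volume.restrict (Ioi (0 : ℝ))), ENNReal.ofReal (2 * eta a b t) < ⊤ :=
    Filter.Eventually.of_forall fun _ => ENNReal.ofReal_lt_top
  refine ⟨(volume.restrict (Ioi 0)).withDensity fun t => ENNReal.ofReal (2 * eta a b t), 0,
    withDensity_absolutelyContinuous _ _ ?_, le_rfl, fun x hx => ?_⟩
  · rw [Measure.restrict_apply measurableSet_Iio, Iio_inter_Ioi, Ioo_self, measure_empty]
  · have heq : EqOn (fun t => 2 * (eta a b t / (x + t) ^ 3))
        (fun t => (ENNReal.ofReal (2 * eta a b t)).toReal • (x + t) ^ (-3 : ℝ)) (Ioi 0) := by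
      intro t ht
      have hxt : 0 ≤ x + t := by linarith [mem_Ioi.1 ht]
      simp only
      rw [ENNReal.toReal_ofReal (mul_nonneg zero_le_two (hnonneg t)), Real.rpow_neg hxt,
        smul_eq_mul, mul_assoc, div_eq_mul_inv]
      norm_cast
    refine ⟨(integrable_withDensity_iff_integrable_smul' hmeas hfin).2 ?_, ?_⟩
    · exact IntegrableOn.congr_fun ((hrepr x hx).1.const_mul 2) heq measurableSet_Ioi
    · rw [integral_withDensity_eq_integral_toReal_smul hmeas hfin, add_zero,
        ← setIntegral_congr_fun measurableSet_Ioi heq, integral_const_mul]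
      exact hmain x hx
end

section
/- Let (a,b) satisfy 0 < b < a and a > 1. Then the function x ↦ x^{1-(a-b)} M_{a,b}'(x) belongs to the generalized Stieltjes class S_{a-b+4} (equivalently, M_{a,b} is a higher order Thorin-Bernstein function of the class T_{a-b,-3}). -/
open MeasureTheory Real Set

/-- `f` is, on `(0, ∞)`, the Laplace transform of a positive measure on `[0, ∞)`. -/
def IsLaplaceTransform (f : ℝ → ℝ) : Prop :=
  ∃ ν : Measure ℝ, SFinite ν ∧ ν (Iio 0) = 0 ∧ ∀ u : ℝ, 0 < u →
    0 ≤ f u ∧ ∫⁻ t, ENNReal.ofReal (exp (-(t * u))) ∂ν = ENNReal.ofReal (f u)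

lemma lintegral_rpow_mul_exp_neg_mul_Ioi {r u : ℝ} (hr : 0 < r) (hu : 0 < u) :
    ∫⁻ t in Ioi 0, ENNReal.ofReal (t ^ (r - 1) * exp (-(u * t)))
      = ENNReal.ofReal (Gamma r * u ^ (-r)) := by
  have h := integral_rpow_mul_exp_neg_mul_Ioi hr hu
  rw [← ofReal_integral_eq_lintegral_ofReal, h, one_div, inv_rpow hu.le, rpow_neg hu.le, mul_comm]
  · refine Integrable.of_integral_ne_zero ?_
    rw [h]
    have := Gamma_pos_of_pos hr
    positivity
  · filter_upwards [ae_restrict_mem measurableSet_Ioi] with t ht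
    have : 0 < t := ht
    positivity

namespace IsLaplaceTransform

variable {f g : ℝ → ℝ}

lemma congr (hf : IsLaplaceTransform f) (h : ∀ u, 0 < u → f u = g u) : IsLaplaceTransform g := by
  obtain ⟨ν, h1, h2, h3⟩ := hf
  exact ⟨ν, h1, h2, fun u hu => h u hu ▸ h3 u hu⟩

lemma mul (hf : IsLaplaceTransform f) (hg : IsLaplaceTransform g) :
    IsLaplaceTransform (fun u => f u * g u) := by
  obtain ⟨μ, h1, h2, h3⟩ := hf
  obtain ⟨ν, k1, k2, k3⟩ := hg
  refine ⟨μ ∗ ν, inferInstance, ?_, fun u hu => ⟨mul_nonneg (h3 u hu).1 (k3 u hu).1, ?_⟩⟩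
  · rw [← lintegral_indicator_one measurableSet_Iio,
      Measure.lintegral_conv (measurable_one.indicator measurableSet_Iio)]
    have hμ : ∀ᵐ x ∂μ, 0 ≤ x := by simpa [ae_iff, Iio_def] using! h2
    have hν : ∀ᵐ x ∂ν, 0 ≤ x := by simpa [ae_iff, Iio_def] using! k2
    refine (lintegral_congr_ae (g := 0) ?_).trans (by simp)
    filter_upwards [hμ] with x hx
    refine (lintegral_congr_ae (g := 0) ?_).trans (by simp)
    filter_upwards [hν] with y hy
    simp [add_nonneg hx hy]
  · rw [Measure.lintegral_conv (by fun_prop), ENNReal.ofReal_mul (h3 u hu).1, ← (h3 u hu).2,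
      ← (k3 u hu).2, ← lintegral_mul_const _ (by fun_prop)]
    refine lintegral_congr fun x => ?_
    rw [← lintegral_const_mul _ (by fun_prop)]
    refine lintegral_congr fun y => ?_
    rw [← ENNReal.ofReal_mul (exp_nonneg _), ← exp_add]
    ring_nf

lemma hasSum {F : ℕ → ℝ → ℝ} (hF : ∀ n, IsLaplaceTransform (F n))
    (h : ∀ u, 0 < u → HasSum (fun n => F n u) (f u)) : IsLaplaceTransform f := by
  choose μ h1 h2 h3 using hF
  refine ⟨Measure.sum μ, inferInstance, ?_, fun u hu =>
    ⟨(h u hu).nonneg fun n => (h3 n u hu).1, ?_⟩⟩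
  · simp [Measure.sum_apply _ measurableSet_Iio, h2]
  · rw [lintegral_sum_measure, ← (h u hu).tsum_eq,
      ENNReal.ofReal_tsum_of_nonneg (fun n => (h3 n u hu).1) (h u hu).summable]
    exact tsum_congr fun n => (h3 n u hu).2

lemma const_mul {c : ℝ} (hc : 0 ≤ c) (hf : IsLaplaceTransform f) :
    IsLaplaceTransform (fun u => c * f u) := by
  obtain ⟨μ, h1, h2, h3⟩ := hf
  refine ⟨ENNReal.ofReal c • μ, inferInstance, by simp [h2], fun u hu =>
    ⟨mul_nonneg hc (h3 u hu).1, ?_⟩⟩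
  rw [lintegral_smul_measure, (h3 u hu).2, ENNReal.ofReal_mul hc, smul_eq_mul]

lemma exp_neg_mul {b : ℝ} (hb : 0 ≤ b) : IsLaplaceTransform (fun u => Real.exp (-(b * u))) :=
  ⟨Measure.dirac b, inferInstance, by simp [hb], fun u _ =>
    ⟨(Real.exp_pos _).le, by rw [lintegral_dirac]⟩⟩

lemma one : IsLaplaceTransform (fun _ => 1) :=
  (exp_neg_mul le_rfl).congr (by simp)

lemma pow (hf : IsLaplaceTransform f) (n : ℕ) : IsLaplaceTransform (fun u => f u ^ n) := by
  induction n with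
  | zero => simpa using one
  | succ n ih => simpa [pow_succ] using ih.mul hf

lemma exp_comp (hf : IsLaplaceTransform f) : IsLaplaceTransform (fun u => Real.exp (f u)) := by
  refine hasSum (F := fun n u => (n.factorial : ℝ)⁻¹ * f u ^ n)
    (fun n => (hf.pow n).const_mul (by positivity)) fun u _ => ?_
  have := NormedSpace.expSeries_div_hasSum_exp (f u)
  rw [← Real.exp_eq_exp_ℝ] at this
  simpa [div_eq_inv_mul] using this

lemma of_density {w : ℝ → ℝ} (hw : Measurable w) (hw0 : ∀ t, 0 < t → 0 ≤ w t)
    (h : ∀ u, 0 < u → 0 ≤ f u ∧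
      ∫⁻ t in Ioi 0, ENNReal.ofReal (w t * Real.exp (-(u * t))) = ENNReal.ofReal (f u)) :
    IsLaplaceTransform f := by
  refine ⟨(volume.restrict (Ioi 0)).withDensity fun t => ENNReal.ofReal (w t), inferInstance, ?_,
    fun u hu => ⟨(h u hu).1, ?_⟩⟩
  · refine withDensity_absolutelyContinuous _ _ ?_
    rw [Measure.restrict_apply measurableSet_Iio, Iio_inter_Ioi, Ioo_self, measure_empty]
  · rw [lintegral_withDensity_eq_lintegral_mul _ (by fun_prop) (by fun_prop), ← (h u hu).2]
    refine setLIntegral_congr_fun measurableSet_Ioi fun t ht => ?_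
    simp only [Pi.mul_apply]
    rw [← ENNReal.ofReal_mul (hw0 t ht), mul_comm u t]

lemma rpow_neg {r : ℝ} (hr : 0 < r) : IsLaplaceTransform (fun u => u ^ (-r)) := by
  have hΓ := Gamma_pos_of_pos hr
  have : IsLaplaceTransform (fun u => Gamma r * u ^ (-r)) :=
    of_density (w := fun t => t ^ (r - 1)) (by fun_prop) (fun t ht => by positivity)
      fun u hu => ⟨by positivity, lintegral_rpow_mul_exp_neg_mul_Ioi hr hu⟩
  refine (this.const_mul (inv_nonneg.2 hΓ.le)).congr fun u _ => ?_
  field_simp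

lemma one_sub_exp_neg_rpow_neg {q : ℝ} (hq : 0 ≤ q) :
    IsLaplaceTransform (fun u => (1 - Real.exp (-u)) ^ (-q)) := by
  have hlog : IsLaplaceTransform (fun u => -log (1 - Real.exp (-u))) := by
    refine hasSum (F := fun n u => ((n : ℝ) + 1)⁻¹ * Real.exp (-(((n : ℝ) + 1) * u)))
      (fun n => (exp_neg_mul (by positivity)).const_mul (by positivity)) fun u hu => ?_
    have := hasSum_pow_div_log_of_abs_lt_one (x := Real.exp (-u))
      (by rw [abs_of_pos (Real.exp_pos _)]; simpa using hu)
    convert this using 2 with n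
    rw [← Real.exp_nat_mul, div_eq_inv_mul]
    push_cast
    ring_nf
  refine (hlog.const_mul hq).exp_comp.congr fun u hu => ?_
  rw [rpow_def_of_pos (by simpa using hu)]
  ring_nf

lemma linear_on_unit_interval {b p : ℝ} (hb : 0 ≤ b) (hbp : 0 ≤ b + p) :
    IsLaplaceTransform
      (fun u => (1 - Real.exp (-u)) * ((b + p * (1 / u - 1 / (Real.exp u - 1))) / u)) := by
  have hw : ∀ t ∈ Ioc (0 : ℝ) 1, 0 ≤ b + p * t := fun t ht => by
    nlinarith [mul_nonneg hb (sub_nonneg.2 ht.2), mul_nonneg hbp ht.1.le]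
  have key : ∀ u, 0 < u → ∫ t in (0 : ℝ)..1, (b + p * t) * Real.exp (-(u * t)) =
      (1 - Real.exp (-u)) * ((b + p * (1 / u - 1 / (Real.exp u - 1))) / u) := fun u hu => by
    rw [intervalIntegral.integral_eq_sub_of_hasDerivAt
      (f := fun t => -(((b + p * t) / u + p / u ^ 2) * Real.exp (-(u * t))))]
    · have : 1 < Real.exp u := by simpa using hu
      have h1 : Real.exp u - 1 ≠ 0 := by linarith
      simp only [mul_one, mul_zero, neg_zero, Real.exp_zero, add_zero, Real.exp_neg]
      field_simp
      ring
    · intro t _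
      have h1 : HasDerivAt (fun t : ℝ => Real.exp (-(u * t)))
          (Real.exp (-(u * t)) * -(u * 1)) t := (((hasDerivAt_id t).const_mul u).neg).exp
      have h2 : HasDerivAt (fun t : ℝ => (b + p * t) / u + p / u ^ 2) (p * 1 / u) t :=
        ((((hasDerivAt_id t).const_mul p).const_add b).div_const u).add_const _
      convert! (h2.mul h1).neg using 1
      field_simp
      ring
    · exact (Continuous.intervalIntegrable (by fun_prop) _ _)
  refine of_density (w := (Ioc (0 : ℝ) 1).indicator fun t => b + p * t)
    (Measurable.indicator (by fun_prop) measurableSet_Ioc)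
    (fun t _ => indicator_nonneg hw t) fun u hu => ?_
  rw [← key u hu]
  have hnn : ∀ t ∈ Ioc (0 : ℝ) 1, 0 ≤ (b + p * t) * Real.exp (-(u * t)) :=
    fun t ht => mul_nonneg (hw t ht) (Real.exp_pos _).le
  rw [intervalIntegral.integral_of_le zero_le_one]
  refine ⟨setIntegral_nonneg measurableSet_Ioc hnn, ?_⟩
  rw [ofReal_integral_eq_lintegral_ofReal
    (Continuous.integrableOn_Ioc (by fun_prop))
    ((ae_restrict_iff' measurableSet_Ioc).2 (.of_forall hnn)),
    ← lintegral_indicator measurableSet_Ioc, ← lintegral_indicator measurableSet_Ioi]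
  refine lintegral_congr fun t => ?_
  by_cases ht : t ∈ Ioc (0 : ℝ) 1
  · simp [ht, show t ∈ Ioi (0 : ℝ) from ht.1]
  · by_cases h0 : t ∈ Ioi (0 : ℝ) <;> simp only [ht, h0, indicator_of_mem, indicator_of_notMem,
      not_false_iff, zero_mul, ENNReal.ofReal_zero]

end IsLaplaceTransform

/-- The function `u ↦ e^{-bu} ((1 - e^{-u}) / u)^p`, which represents `M` as
`Γ(p+1) M_{b+p+1,b}(x) = ∫₀^∞ e^{-v} v^p ratioKernel b p (v/x) dv`. -/
noncomputable def ratioKernel (b p u : ℝ) : ℝ := exp (-(b * u)) * ((1 - exp (-u)) / u) ^ p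

/-- Minus the logarithmic derivative of `ratioKernel b p`. -/
noncomputable def ratioKernelLogDeriv (b p u : ℝ) : ℝ := b + p * (1 / u - 1 / (exp u - 1))

@[fun_prop]
lemma measurable_ratioKernel (b p : ℝ) : Measurable (ratioKernel b p) := by
  unfold ratioKernel; fun_prop

@[fun_prop]
lemma measurable_ratioKernelLogDeriv (b p : ℝ) : Measurable (ratioKernelLogDeriv b p) := by
  unfold ratioKernelLogDeriv; fun_prop

lemma one_sub_exp_neg_pos {u : ℝ} (hu : 0 < u) : 0 < 1 - exp (-u) := by simpa using hu

lemma ratioKernel_pos (b p : ℝ) {u : ℝ} (hu : 0 < u) : 0 < ratioKernel b p u :=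
  mul_pos (exp_pos _) (rpow_pos_of_pos (div_pos (one_sub_exp_neg_pos hu) hu) _)

lemma hasDerivAt_ratioKernel (b p : ℝ) {u : ℝ} (hu : 0 < u) :
    HasDerivAt (ratioKernel b p) (-(ratioKernel b p u * ratioKernelLogDeriv b p u)) u := by
  have hq := one_sub_exp_neg_pos hu
  have h1 : HasDerivAt (fun u : ℝ => exp (-(b * u))) (exp (-(b * u)) * -(b * 1)) u :=
    (((hasDerivAt_id u).const_mul b).neg).exp
  have h2 : HasDerivAt (fun u : ℝ => (1 - exp (-u)) / u)
      ((-(exp (-u) * -1) * u - (1 - exp (-u)) * 1) / u ^ 2) u :=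
    ((((hasDerivAt_id u).neg).exp).const_sub 1).div (hasDerivAt_id u) hu.ne'
  have h3 := h1.mul (h2.rpow_const (p := p) (Or.inl (div_pos hq hu).ne'))
  have hlt : 1 < exp u := by simpa using hu
  have hne : exp u - 1 ≠ 0 := by linarith
  refine h3.congr_deriv ?_
  rw [ratioKernel, ratioKernelLogDeriv, rpow_sub_one (div_pos hq hu).ne']
  have hq' := hq.ne'
  rw [exp_neg u] at hq' ⊢
  have : 1 - (exp u)⁻¹ = (exp u - 1) / exp u := by field_simp
  generalize ((1 - (exp u)⁻¹) / u) ^ p = R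
  rw [this]
  field_simp
  ring

lemma one_div_sub_one_div_exp_sub_one_mem {u : ℝ} (hu : 0 < u) :
    1 / u - 1 / (exp u - 1) ∈ Icc (0 : ℝ) 1 := by
  have h1 : u + 1 ≤ exp u := add_one_le_exp u
  have h2 : 0 < exp u - 1 := by linarith
  have h3 : 1 - u ≤ exp (-u) := one_sub_le_exp_neg u
  have h4 : (1 - u) * exp u ≤ 1 := by
    calc _ ≤ exp (-u) * exp u := by gcongr
      _ = 1 := by rw [← exp_add]; simp
  constructor
  · rw [sub_nonneg]
    exact one_div_le_one_div_of_le hu (by linarith)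
  · rw [div_sub_div _ _ hu.ne' h2.ne', div_le_one (by positivity)]
    linarith

lemma abs_ratioKernelLogDeriv_le (b p : ℝ) {u : ℝ} (hu : 0 < u) :
    |ratioKernelLogDeriv b p u| ≤ |b| + |p| := by
  have h := one_div_sub_one_div_exp_sub_one_mem hu
  refine (abs_add_le _ _).trans (add_le_add_right ?_ _)
  rw [abs_mul]
  exact mul_le_of_le_one_right (abs_nonneg _) (abs_le.2 ⟨by linarith [h.1], h.2⟩)

lemma ratioKernelLogDeriv_nonneg {b p : ℝ} (hb : 0 ≤ b) (hbp : 0 ≤ b + p) {u : ℝ} (hu : 0 < u) :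
    0 ≤ ratioKernelLogDeriv b p u := by
  have h := one_div_sub_one_div_exp_sub_one_mem hu
  rw [ratioKernelLogDeriv]
  nlinarith [mul_nonneg hb (sub_nonneg.2 h.2), mul_nonneg hbp h.1]

lemma ratioKernel_le {b p : ℝ} (hb : 0 ≤ b) (hp : -1 ≤ p) {u : ℝ} (hu : 0 < u) :
    ratioKernel b p u ≤ 1 + u := by
  have hq := one_sub_exp_neg_pos hu
  have h1 : exp (-(b * u)) ≤ 1 := by
    rw [exp_le_one_iff]
    nlinarith
  have h2 : 1 - exp (-u) ≤ u := by linarith [one_sub_le_exp_neg u]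
  have h3 : (1 - exp (-u)) / u ≤ 1 := (div_le_one hu).2 h2
  have h0 : 0 < (1 - exp (-u)) / u := div_pos hq hu
  have h4 : ((1 - exp (-u)) / u) ^ p ≤ 1 + u := by
    calc ((1 - exp (-u)) / u) ^ p ≤ ((1 - exp (-u)) / u) ^ (-1 : ℝ) :=
          rpow_le_rpow_of_exponent_ge h0 h3 hp
      _ = u / (1 - exp (-u)) := by rw [rpow_neg_one, inv_div]
      _ ≤ 1 + u := by
        rw [div_le_iff₀ hq]
        have h5 : (1 + u) * exp (-u) ≤ exp u * exp (-u) :=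
          mul_le_mul_of_nonneg_right (by linarith [add_one_le_exp u]) (exp_pos _).le
        rw [← exp_add, add_neg_cancel, exp_zero] at h5
        linarith
  calc ratioKernel b p u ≤ 1 * (1 + u) :=
        mul_le_mul h1 h4 (rpow_nonneg h0.le _) zero_le_one
    _ = 1 + u := one_mul _

lemma image_exp_neg_div_Ioi {x : ℝ} (hx : 0 < x) :
    (fun v => exp (-(v / x))) '' Ioi 0 = Ioo 0 1 := by
  ext y
  constructor
  · rintro ⟨v, hv, rfl⟩
    exact ⟨exp_pos _, by simpa using div_pos hv hx⟩
  · rintro ⟨h0, h1⟩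
    refine ⟨-(x * log y), ?_, ?_⟩
    · have := mul_pos_of_neg_of_neg (neg_lt_zero.2 hx) (log_neg h0 h1)
      simpa [neg_mul] using this
    · have : -(-(x * log y) / x) = log y := by field_simp
      simp only [this, exp_log h0]

lemma lintegral_ratioKernel {a b x : ℝ} (hb : 0 < b) (hba : b < a) (hx : 0 < x) :
    ∫⁻ v in Ioi 0, ENNReal.ofReal (exp (-v) * v ^ (a - b - 1) * ratioKernel b (a - b - 1) (v / x))
      = ENNReal.ofReal (Gamma (a - b) * M a b x) := by
  have hs : 0 < a - b := sub_pos.2 hba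
  have hxb : 0 < x + b := add_pos hx hb
  have hβ := ProbabilityTheory.beta_pos hxb hs
  have hbeta := ProbabilityTheory.lintegral_betaPDF_eq_one hxb hs
  have hderiv : ∀ v ∈ Ioi (0 : ℝ), HasDerivWithinAt (fun v => exp (-(v / x)))
      (exp (-(v / x)) * -(1 / x)) (Ioi 0) v := fun v _ =>
    ((((hasDerivAt_id v).div_const x).neg).exp).hasDerivWithinAt
  rw [ProbabilityTheory.lintegral_betaPDF, ← image_exp_neg_div_Ioi hx,
    lintegral_image_eq_lintegral_abs_deriv_mul measurableSet_Ioi hderiv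
      (fun v _ w _ h => by simpa [hx.ne'] using h)] at hbeta
  have hMβ : Gamma (a - b) * M a b x
      = x ^ (a - b) * ProbabilityTheory.beta (x + b) (a - b) := by
    rw [M, ProbabilityTheory.beta, show x + b + (a - b) = x + a by ring]
    ring
  have hc : 0 ≤ Gamma (a - b) * M a b x := by rw [hMβ]; positivity
  rw [← mul_one (ENNReal.ofReal (Gamma (a - b) * M a b x)), ← hbeta,
    ← lintegral_const_mul' _ _ ENNReal.ofReal_ne_top]
  refine setLIntegral_congr_fun measurableSet_Ioi fun v hv => ?_
  have hv : 0 < v := hv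
  rw [← ENNReal.ofReal_mul (abs_nonneg _), ← ENNReal.ofReal_mul hc, hMβ, abs_mul, abs_neg,
    abs_of_pos (exp_pos _), abs_of_pos (one_div_pos.2 hx), ratioKernel,
    div_rpow (one_sub_exp_neg_pos (div_pos hv hx)).le (div_pos hv hx).le,
    div_rpow hv.le hx.le, rpow_sub_one hx.ne', ← exp_mul]
  congr 1
  have h1 : exp (-v) * exp (-(b * (v / x)))
      = exp (-(v / x)) * exp (-(v / x) * (x + b - 1)) := by
    rw [← exp_add, ← exp_add]
    congr 1
    field_simp
    ring
  have hvp : v ^ (a - b - 1) ≠ 0 := (rpow_pos_of_pos hv _).ne'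
  have hxp : x ^ (a - b) ≠ 0 := (rpow_pos_of_pos hx _).ne'
  generalize (1 - exp (-(v / x))) ^ (a - b - 1) = R
  calc _ = (exp (-v) * exp (-(b * (v / x)))) * (v ^ (a - b - 1) *
        (R / (v ^ (a - b - 1) / (x ^ (a - b) / x)))) := by ring
    _ = _ := by rw [h1]; field_simp

lemma integrableOn_exp_neg_mul_ratioKernel {a b x : ℝ} (hb : 0 < b) (hba : b < a) (hx : 0 < x) :
    IntegrableOn (fun v => exp (-v) * v ^ (a - b - 1) * ratioKernel b (a - b - 1) (v / x))
      (Ioi 0) := by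
  refine ⟨Measurable.aestronglyMeasurable (by fun_prop), ?_⟩
  rw [hasFiniteIntegral_iff_ofReal, lintegral_ratioKernel hb hba hx]
  · exact ENNReal.ofReal_lt_top
  · filter_upwards [ae_restrict_mem measurableSet_Ioi] with v hv
    exact mul_nonneg (mul_nonneg (exp_pos _).le (rpow_nonneg (le_of_lt hv) _))
      (ratioKernel_pos _ _ (div_pos hv hx)).le

lemma M_eq_integral_ratioKernel {a b x : ℝ} (hb : 0 < b) (hba : b < a) (hx : 0 < x) :
    M a b x = (Gamma (a - b))⁻¹ *
      ∫ v in Ioi 0, exp (-v) * v ^ (a - b - 1) * ratioKernel b (a - b - 1) (v / x) := by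
  have hΓ := Gamma_pos_of_pos (sub_pos.2 hba)
  have hM : 0 ≤ M a b x := by
    have h1 := Gamma_pos_of_pos (add_pos hx hb)
    have h2 := Gamma_pos_of_pos (add_pos hx (hb.trans hba))
    rw [M]
    positivity
  rw [integral_eq_lintegral_of_nonneg_ae, lintegral_ratioKernel hb hba hx,
    ENNReal.toReal_ofReal (mul_nonneg hΓ.le hM), inv_mul_cancel_left₀ hΓ.ne']
  · filter_upwards [ae_restrict_mem measurableSet_Ioi] with v hv
    exact mul_nonneg (mul_nonneg (exp_pos _).le (rpow_nonneg (le_of_lt hv) _))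
      (ratioKernel_pos _ _ (div_pos hv hx)).le
  · exact Measurable.aestronglyMeasurable (by fun_prop)

lemma integrableOn_and_hasDerivAt_M {a b x : ℝ} (hb : 0 < b) (hba : b < a) (hx : 0 < x) :
    IntegrableOn (fun v => exp (-v) * v ^ (a - b - 1) * (ratioKernel b (a - b - 1) (v / x) *
      ratioKernelLogDeriv b (a - b - 1) (v / x) * (v / x ^ 2))) (Ioi 0) ∧
    HasDerivAt (M a b) ((Gamma (a - b))⁻¹ *
      ∫ v in Ioi 0, exp (-v) * v ^ (a - b - 1) * (ratioKernel b (a - b - 1) (v / x) *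
        ratioKernelLogDeriv b (a - b - 1) (v / x) * (v / x ^ 2))) x := by
  set p := a - b - 1 with hp
  have hp1 : -1 < p := by linarith
  have hx2 : 0 < x / 2 := half_pos hx
  have key := hasDerivAt_integral_of_dominated_loc_of_deriv_le
    (μ := volume.restrict (Ioi 0)) (s := Ioi (x / 2)) (x₀ := x)
    (F := fun y v => exp (-v) * v ^ p * ratioKernel b p (v / y))
    (F' := fun y v => exp (-v) * v ^ p * (ratioKernel b p (v / y) *
      ratioKernelLogDeriv b p (v / y) * (v / y ^ 2)))
    (bound := fun v => (|b| + |p|) / (x / 2) ^ 2 * (exp (-v) * v ^ (p + 2 - 1)) +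
      (|b| + |p|) / (x / 2) ^ 3 * (exp (-v) * v ^ (p + 3 - 1)))
    (Ioi_mem_nhds (half_lt_self hx))
    (.of_forall fun y => Measurable.aestronglyMeasurable (by fun_prop))
    (integrableOn_exp_neg_mul_ratioKernel hb hba hx)
    (Measurable.aestronglyMeasurable (by fun_prop)) ?_
    (((GammaIntegral_convergent (by linarith)).const_mul _).add
      ((GammaIntegral_convergent (by linarith)).const_mul _)) ?_
  · refine ⟨key.1, (key.2.const_mul (Gamma (a - b))⁻¹).congr_of_eventuallyEq ?_⟩
    filter_upwards [Ioi_mem_nhds hx] with y hy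
    exact M_eq_integral_ratioKernel hb hba hy
  · filter_upwards [ae_restrict_mem measurableSet_Ioi] with v hv y hy
    have hv : 0 < v := hv
    have hy : x / 2 < y := hy
    have hy0 : 0 < y := hx2.trans hy
    have hG := ratioKernel_pos b p (div_pos hv hy0)
    have hG1 := ratioKernel_le hb.le hp1.le (div_pos hv hy0)
    have hB := abs_ratioKernelLogDeriv_le b p (div_pos hv hy0)
    rw [norm_mul, norm_mul, norm_mul, norm_mul, norm_eq_abs, norm_eq_abs, norm_eq_abs,
      norm_eq_abs, norm_eq_abs, abs_of_pos (exp_pos _), abs_of_pos (rpow_pos_of_pos hv _),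
      abs_of_pos hG, abs_of_pos (div_pos hv (pow_pos hy0 2))]
    calc _ ≤ exp (-v) * v ^ p *
          ((1 + v / (x / 2)) * (|b| + |p|) * (v / (x / 2) ^ 2)) := by
          refine mul_le_mul_of_nonneg_left ?_ (by positivity)
          refine mul_le_mul (mul_le_mul (hG1.trans ?_) hB (abs_nonneg _) (by positivity)) ?_
            (by positivity) (by positivity)
          · gcongr
          · gcongr
      _ = _ := by
          rw [show p + 2 - 1 = p + 1 by ring, show p + 3 - 1 = p + 1 + 1 by ring,
            rpow_add_one hv.ne', rpow_add_one hv.ne']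
          field_simp
          rw [rpow_add_one hv.ne']
          ring
  · filter_upwards [ae_restrict_mem measurableSet_Ioi] with v hv y hy
    have hy0 : 0 < y := hx2.trans hy
    have h1 : HasDerivAt (fun y : ℝ => v / y) (-v / y ^ 2) y := by
      simpa using! (hasDerivAt_const y v).div (hasDerivAt_id y) hy0.ne'
    have h2 := (hasDerivAt_ratioKernel b p (div_pos hv hy0)).comp y h1
    refine (h2.const_mul (exp (-v) * v ^ p)).congr_deriv ?_
    ring

lemma rpow_mul_deriv_M {a b x : ℝ} (hb : 0 < b) (hba : b < a) (hx : 0 < x) :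
    IntegrableOn (fun u => exp (-(x * u)) * u ^ (a - b) * (ratioKernel b (a - b - 1) u *
      ratioKernelLogDeriv b (a - b - 1) u)) (Ioi 0) ∧
    x ^ (1 - (a - b)) * deriv (M a b) x = (Gamma (a - b))⁻¹ *
      ∫ u in Ioi 0, exp (-(x * u)) * u ^ (a - b) * (ratioKernel b (a - b - 1) u *
        ratioKernelLogDeriv b (a - b - 1) u) := by
  obtain ⟨hI, hD⟩ := integrableOn_and_hasDerivAt_M hb hba hx
  rw [hD.deriv]
  set φ : ℝ → ℝ := fun v => exp (-v) * v ^ (a - b - 1) * (ratioKernel b (a - b - 1) (v / x) *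
    ratioKernelLogDeriv b (a - b - 1) (v / x) * (v / x ^ 2)) with hφ
  have hxp : x ^ (1 - (a - b)) * x ^ (a - b - 1) = 1 := by
    rw [← rpow_add hx]; simp
  have hEq : ∀ u ∈ Ioi (0 : ℝ), exp (-(x * u)) * u ^ (a - b) * (ratioKernel b (a - b - 1) u *
      ratioKernelLogDeriv b (a - b - 1) u) = x ^ (1 - (a - b)) * x * φ (x * u) := by
    intro u hu
    have hu : 0 < u := hu
    simp only [hφ]
    rw [mul_div_cancel_left₀ _ hx.ne', mul_rpow hx.le hu.le,
      show a - b = a - b - 1 + 1 by ring, rpow_add_one hu.ne',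
      show a - b - 1 + 1 - 1 = a - b - 1 by ring, show a - b - 1 + 1 = a - b by ring]
    calc _ = (x ^ (1 - (a - b)) * x ^ (a - b - 1)) * (exp (-(x * u)) * (u ^ (a - b - 1) * u) *
          (ratioKernel b (a - b - 1) u * ratioKernelLogDeriv b (a - b - 1) u)) := by
          rw [hxp, one_mul]
      _ = _ := by field_simp
  constructor
  · refine IntegrableOn.congr_fun ?_ (fun u hu => (hEq u hu).symm) measurableSet_Ioi
    refine Integrable.const_mul ?_ _
    have := (integrableOn_Ioi_comp_mul_left_iff φ 0 hx).2 (by simpa using hI)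
    exact this
  · rw [setIntegral_congr_fun measurableSet_Ioi hEq, integral_const_mul,
      integral_comp_mul_left_Ioi φ 0 hx, mul_zero, smul_eq_mul]
    field_simp

/-- Writing `p = m - q` with `m : ℕ` and `q ∈ [0, 1)`, the function is a product of Laplace
transforms of positive measures. -/
lemma isLaplaceTransform_ratioKernel {b p : ℝ} (hb : 0 ≤ b) (hbp : 0 ≤ b + p) (hp : -1 < p) :
    IsLaplaceTransform (fun u => (ratioKernel b p u * ratioKernelLogDeriv b p u) / u ^ 3) := by
  obtain ⟨m, q, hq0, hq1, rfl⟩ : ∃ (m : ℕ) (q : ℝ), 0 ≤ q ∧ q < 1 ∧ p = m - q := by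
    refine ⟨⌈p⌉₊, ⌈p⌉₊ - p, sub_nonneg.2 (Nat.le_ceil p), ?_, by ring⟩
    rcases le_total 0 p with h | h
    · linarith [Nat.ceil_lt_add_one h]
    · rw [Nat.ceil_eq_zero.2 h]
      push_cast
      linarith
  have hB := IsLaplaceTransform.linear_on_unit_interval hb hbp
  have hU := IsLaplaceTransform.linear_on_unit_interval (b := 1) (p := 0) (by simp) (by simp)
  have h := ((((IsLaplaceTransform.exp_neg_mul hb).mul (hU.pow m)).mul
    (IsLaplaceTransform.rpow_neg (r := 2 - q) (by linarith))).mul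
      (IsLaplaceTransform.one_sub_exp_neg_rpow_neg (q := q + 1) (by linarith))).mul hB
  refine h.congr fun u hu => ?_
  have hy := one_sub_exp_neg_pos hu
  rw [ratioKernel, ratioKernelLogDeriv, rpow_sub (div_pos hy hu), rpow_natCast,
    div_rpow hy.le hu.le, neg_add, ← sub_eq_add_neg, rpow_sub_one hy.ne', rpow_neg hy.le,
    show -(2 - q) = q - (2 : ℕ) by push_cast; ring, rpow_sub_natCast hu.ne']
  have h1 := (rpow_pos_of_pos hy q).ne'
  have h2 := (rpow_pos_of_pos hu q).ne'
  have h3 := hy.ne'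
  simp only [zero_mul, add_zero, mul_one_div]
  generalize b + (m - q) * (1 / u - 1 / (exp u - 1)) = B
  generalize (1 - exp (-u)) ^ q = Y at *
  generalize u ^ q = U at *
  generalize 1 - exp (-u) = y at *
  field_simp

lemma lintegral_exp_neg_mul_rpow_mul_laplace {ν : Measure ℝ} [SFinite ν] (hν : ∀ᵐ t ∂ν, 0 ≤ t)
    {lam x : ℝ} (hlam : 0 < lam) (hx : 0 < x) :
    ∫⁻ u in Ioi 0, ENNReal.ofReal (exp (-(x * u)) * u ^ (lam - 1)) *
        ∫⁻ t, ENNReal.ofReal (exp (-(t * u))) ∂ν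
      = ENNReal.ofReal (Gamma lam) * ∫⁻ t, ENNReal.ofReal ((x + t) ^ (-lam)) ∂ν := by
  calc _ = ∫⁻ u in Ioi 0, ∫⁻ t, ENNReal.ofReal (exp (-(x * u)) * u ^ (lam - 1)) *
        ENNReal.ofReal (exp (-(t * u))) ∂ν :=
        lintegral_congr fun u => (lintegral_const_mul' _ _ ENNReal.ofReal_ne_top).symm
    _ = ∫⁻ t, (∫⁻ u in Ioi 0, ENNReal.ofReal (exp (-(x * u)) * u ^ (lam - 1)) *
        ENNReal.ofReal (exp (-(t * u)))) ∂ν := lintegral_lintegral_swap (by fun_prop)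
    _ = ∫⁻ t, ENNReal.ofReal (Gamma lam) * ENNReal.ofReal ((x + t) ^ (-lam)) ∂ν := by
        refine lintegral_congr_ae ?_
        filter_upwards [hν] with t ht
        rw [← ENNReal.ofReal_mul (Gamma_pos_of_pos hlam).le,
          ← lintegral_rpow_mul_exp_neg_mul_Ioi hlam (by linarith)]
        refine setLIntegral_congr_fun measurableSet_Ioi fun u hu => ?_
        have hu : 0 < u := hu
        rw [← ENNReal.ofReal_mul (by positivity)]
        congr 1
        rw [add_mul, neg_add, exp_add]
        ring
    _ = _ := lintegral_const_mul' _ _ ENNReal.ofReal_ne_top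

/-- `M_{a,b} ∈ T_{a-b,-3}`: the function `x^{1-(a-b)} M_{a,b}'(x)` is a generalized
Stieltjes function of order `(a-b)+1-(-3) = a-b+4`. -/
theorem M_mem_thorinBernstein (a b : ℝ) (hb : 0 < b) (hba : b < a) (ha : 1 < a) :
    IsGenStieltjes (a - b + 4) (fun x => x ^ (1 - (a - b)) * deriv (M a b) x) := by
  have hs : 0 < a - b := sub_pos.2 hba
  have hΓ := Gamma_pos_of_pos hs
  have hΓ' := Gamma_pos_of_pos (show 0 < a - b + 4 by linarith)
  have hbp : 0 ≤ b + (a - b - 1) := by linarith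
  obtain ⟨ν, hν1, hν2, hν⟩ :=
    isLaplaceTransform_ratioKernel hb.le hbp (show -1 < a - b - 1 by linarith)
  have hν0 : ∀ᵐ t ∂ν, 0 ≤ t := by simpa [ae_iff, Iio_def] using! hν2
  set C := (Gamma (a - b))⁻¹ * Gamma (a - b + 4) with hC
  have hC0 : 0 ≤ C := by positivity
  refine ⟨ENNReal.ofReal C • ν, 0, by simp [hν2], le_rfl, fun x hx => ?_⟩
  obtain ⟨hI, hD⟩ := rpow_mul_deriv_M hb hba hx
  have hnn : 0 ≤ᵐ[volume.restrict (Ioi 0)] fun u => exp (-(x * u)) * u ^ (a - b) *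
      (ratioKernel b (a - b - 1) u * ratioKernelLogDeriv b (a - b - 1) u) := by
    filter_upwards [ae_restrict_mem measurableSet_Ioi] with u hu
    have hu : 0 < u := hu
    have := ratioKernel_pos b (a - b - 1) hu
    have := ratioKernelLogDeriv_nonneg hb.le hbp hu
    positivity
  have hlint : ∫⁻ t, ENNReal.ofReal ((x + t) ^ (-(a - b + 4))) ∂(ENNReal.ofReal C • ν)
      = ENNReal.ofReal (x ^ (1 - (a - b)) * deriv (M a b) x) := by
    rw [hD, lintegral_smul_measure, hC, ENNReal.ofReal_mul (inv_nonneg.2 hΓ.le),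
      ENNReal.ofReal_mul (inv_nonneg.2 hΓ.le), ofReal_integral_eq_lintegral_ofReal hI hnn,
      smul_eq_mul, mul_assoc, ← lintegral_exp_neg_mul_rpow_mul_laplace hν0 (by linarith) hx]
    congr 1
    refine setLIntegral_congr_fun measurableSet_Ioi fun u hu => ?_
    have hu : 0 < u := hu
    rw [(hν u hu).2, ← ENNReal.ofReal_mul (by positivity)]
    congr 1
    rw [show a - b + 4 - 1 = a - b + (3 : ℕ) by push_cast; ring, rpow_add_natCast hu.ne']
    field_simp
  have hnn' : 0 ≤ᵐ[ENNReal.ofReal C • ν] fun t => (x + t) ^ (-(a - b + 4)) := by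
    filter_upwards [Measure.ae_smul_measure hν0 (ENNReal.ofReal C)] with t ht
    exact rpow_nonneg (by linarith) _
  have hmeas : Measurable fun t : ℝ => (x + t) ^ (-(a - b + 4)) := by fun_prop
  refine ⟨⟨hmeas.aestronglyMeasurable, ?_⟩, ?_⟩
  · rw [hasFiniteIntegral_iff_ofReal hnn', hlint]
    exact ENNReal.ofReal_lt_top
  · rw [integral_eq_lintegral_of_nonneg_ae hnn' hmeas.aestronglyMeasurable, hlint, add_zero,
      ENNReal.toReal_ofReal]
    rw [hD]
    exact mul_nonneg (inv_nonneg.2 hΓ.le) (integral_nonneg_of_ae hnn)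
end

section
/- Let (a,b) satisfy 0 < b < a, a > 1 and a - b > 1, and define L_{a,b}(x) = x(1 - M_{a,b}(x)) for x > 0. Then L_{a,b} belongs to the generalized Bernstein class B_{a-b}, i.e. the function x ↦ x^{1-(a-b)} L_{a,b}'(x) is completely monotonic on (0,∞). -/
open MeasureTheory Real Set

/-- `L_{a,b}(x) = x (1 - M_{a,b}(x))`. -/
noncomputable def L (a b : ℝ) (x : ℝ) : ℝ := x * (1 - M a b x)

/-- `f` is completely monotonic on `(0,∞)`: infinitely differentiable there, with
`(-1)^n f^{(n)}(x) ≥ 0` for all `n ≥ 0` and `x > 0`. -/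
def CompletelyMonotonicOn (f : ℝ → ℝ) : Prop :=
  ContDiffOn ℝ (⊤ : ℕ∞) f (Set.Ioi 0) ∧
  ∀ (n : ℕ) (x : ℝ), 0 < x → 0 ≤ (-1 : ℝ) ^ n * iteratedDeriv n f x

section LaplaceTransform

variable {w : ℝ → ℝ}

/-- The measure on `(0, ∞)` with density `w`. -/
noncomputable def densityMeasure (w : ℝ → ℝ) : Measure ℝ :=
  (volume.restrict (Ioi 0)).withDensity fun t => ENNReal.ofReal (w t)

lemma integral_densityMeasure (hw : Measurable w) (hw0 : ∀ t, 0 < t → 0 ≤ w t) (g : ℝ → ℝ) :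
    ∫ t, g t ∂densityMeasure w = ∫ t in Ioi 0, w t * g t := by
  rw [densityMeasure, integral_withDensity_eq_integral_toReal_smul hw.ennreal_ofReal
    (by simp)]
  refine setIntegral_congr_fun measurableSet_Ioi fun t ht => ?_
  simp [ENNReal.toReal_ofReal (hw0 t ht)]

lemma mem_interior_integrableExpSet (hw : Measurable w) (hw0 : ∀ t, 0 < t → 0 ≤ w t)
    (hwi : ∀ x, 0 < x → IntegrableOn (fun t => w t * exp (x * -t)) (Ioi 0)) {x : ℝ}
    (hx : 0 < x) :
    x ∈ interior (ProbabilityTheory.integrableExpSet (fun t => -t) (densityMeasure w)) := by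
  refine mem_interior.2 ⟨Ioi 0, fun y hy => ?_, isOpen_Ioi, hx⟩
  rw [ProbabilityTheory.integrableExpSet, mem_ofPred_eq, densityMeasure,
    integrable_withDensity_iff_integrable_smul' hw.ennreal_ofReal (by simp)]
  refine (integrableOn_congr_fun (fun t ht => ?_) measurableSet_Ioi).1 (hwi y hy)
  simp [ENNReal.toReal_ofReal (hw0 t ht)]

lemma hasDerivAt_laplace (hw : Measurable w) (hw0 : ∀ t, 0 < t → 0 ≤ w t)
    (hwi : ∀ x, 0 < x → IntegrableOn (fun t => w t * exp (x * -t)) (Ioi 0)) {x : ℝ}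
    (hx : 0 < x) :
    HasDerivAt (fun x => ∫ t in Ioi 0, w t * exp (x * -t))
      (∫ t in Ioi 0, w t * (-t * exp (x * -t))) x := by
  have := ProbabilityTheory.hasDerivAt_mgf (mem_interior_integrableExpSet hw hw0 hwi hx)
  rw [integral_densityMeasure hw hw0] at this
  refine this.congr_of_eventuallyEq (Filter.Eventually.of_forall fun y => ?_)
  exact (integral_densityMeasure hw hw0 _).symm

lemma CompletelyMonotonicOn.of_laplace {f : ℝ → ℝ} (hw : Measurable w)
    (hw0 : ∀ t, 0 < t → 0 ≤ w t)
    (hwi : ∀ x, 0 < x → IntegrableOn (fun t => w t * exp (x * -t)) (Ioi 0))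
    (hf : ∀ x, 0 < x → f x = ∫ t in Ioi 0, w t * exp (x * -t)) :
    CompletelyMonotonicOn f := by
  have hfm : EqOn f (ProbabilityTheory.mgf (fun t => -t) (densityMeasure w)) (Ioi 0) :=
    fun y hy => (hf y hy).trans (integral_densityMeasure hw hw0 _).symm
  refine ⟨ContDiffOn.congr (fun x hx => ?_) hfm, fun n x hx => ?_⟩
  · exact (ProbabilityTheory.analyticAt_mgf
      (mem_interior_integrableExpSet hw hw0 hwi hx)).contDiffAt.contDiffWithinAt
  · rw [(hfm.eventuallyEq_of_mem (Ioi_mem_nhds hx)).iteratedDeriv_eq,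
      ProbabilityTheory.iteratedDeriv_mgf (mem_interior_integrableExpSet hw hw0 hwi hx),
      integral_densityMeasure hw hw0, ← integral_const_mul]
    refine setIntegral_nonneg measurableSet_Ioi fun t (ht : 0 < t) => ?_
    have : (-1 : ℝ) ^ n * (w t * ((-t) ^ n * exp (x * -t)))
        = w t * (t ^ n * exp (x * -t)) := by
      rw [show t ^ n = (-1) ^ n * (-t) ^ n by rw [← mul_pow]; simp]
      ring
    rw [this]
    have := hw0 t ht
    positivity

end LaplaceTransform

/-- The kernel `e^{-ct} (1 - e^{-t})^ν`. -/
noncomputable def expKernel (c ν t : ℝ) : ℝ := exp (-(c * t)) * (1 - exp (-t)) ^ ν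

section ExpKernel

variable {c ν t : ℝ}

lemma one_sub_exp_neg_pos_s9 (ht : 0 < t) : 0 < 1 - exp (-t) := by
  simpa using ht

lemma expKernel_pos (c ν : ℝ) (ht : 0 < t) : 0 < expKernel c ν t :=
  mul_pos (exp_pos _) (rpow_pos_of_pos (one_sub_exp_neg_pos_s9 ht) _)

@[fun_prop]
lemma measurable_expKernel (c ν : ℝ) : Measurable (expKernel c ν) := by
  unfold expKernel
  fun_prop

lemma expKernel_mul_exp (c ν x t : ℝ) :
    expKernel c ν t * exp (x * -t) = expKernel (c + x) ν t := by
  rw [expKernel, expKernel, mul_right_comm, ← exp_add]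
  ring_nf

lemma expKernel_succ (c ν : ℝ) (ht : 0 < t) :
    expKernel c (ν + 1) t = (1 - exp (-t)) * expKernel c ν t := by
  rw [expKernel, expKernel, rpow_add_one (one_sub_exp_neg_pos_s9 ht).ne']
  ring

lemma expKernel_succ_left (c ν t : ℝ) :
    expKernel (c + 1) ν t = exp (-t) * expKernel c ν t := by
  rw [← expKernel_mul_exp, mul_comm, one_mul]

lemma hasDerivAt_expKernel (c ν : ℝ) (ht : 0 < t) :
    HasDerivAt (expKernel c ν) (-c * expKernel c ν t + ν * expKernel (c + 1) (ν - 1) t) t := by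
  have h1 : HasDerivAt (fun t => exp (-(c * t))) (exp (-(c * t)) * -(c * 1)) t :=
    ((hasDerivAt_id t).const_mul c).neg.exp
  have h2 : HasDerivAt (fun t => 1 - exp (-t)) (-(exp (-t) * -1)) t :=
    (hasDerivAt_id t).neg.exp.const_sub 1
  refine (h1.mul (h2.rpow_const (p := ν) (Or.inl (one_sub_exp_neg_pos_s9 ht).ne'))).congr_deriv ?_
  rw [expKernel_succ_left]
  simp only [expKernel]
  ring

lemma mul_exp_neg_le (t : ℝ) : t * exp (-t) ≤ 1 - exp (-t) := by
  have h := mul_le_mul_of_nonneg_right (add_one_le_exp t) (exp_pos (-t)).le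
  rw [← exp_add, add_neg_cancel, exp_zero] at h
  linarith

lemma mul_expKernel_le (c ν : ℝ) (ht : 0 < t) :
    t * expKernel (c + 1) (ν - 1) t ≤ expKernel c ν t := by
  have h := expKernel_succ c (ν - 1) ht
  rw [sub_add_cancel] at h
  rw [h, expKernel_succ_left, ← mul_assoc]
  exact mul_le_mul_of_nonneg_right (mul_exp_neg_le t) (expKernel_pos _ _ ht).le

lemma mul_expKernel_le_half (hc : 0 < c) (ν : ℝ) (ht : 0 < t) :
    t * expKernel c ν t ≤ 2 / c * expKernel (c / 2) ν t := by
  have h : t * exp (-(c / 2 * t)) ≤ 2 / c := by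
    have h := mul_exp_neg_le (c / 2 * t)
    have := exp_pos (-(c / 2 * t))
    rw [le_div_iff₀ hc]
    nlinarith
  rw [show expKernel c ν t = exp (-(c / 2 * t)) * expKernel (c / 2) ν t by
    rw [show -(c / 2 * t) = c / 2 * -t by ring, mul_comm, expKernel_mul_exp, add_halves],
    ← mul_assoc]
  exact mul_le_mul_of_nonneg_right h (expKernel_pos _ _ ht).le

lemma tendsto_expKernel_zero (c : ℝ) (hν : 0 < ν) :
    Filter.Tendsto (expKernel c ν) (nhdsWithin 0 (Ioi 0)) (nhds 0) := by
  have : ContinuousAt (expKernel c ν) 0 := by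
    unfold expKernel
    refine ContinuousAt.mul (by fun_prop) (ContinuousAt.rpow_const (by fun_prop) (Or.inr hν.le))
  have h := this.tendsto
  rw [show expKernel c ν 0 = 0 by simp [expKernel, hν.ne']] at h
  exact h.mono_left nhdsWithin_le_nhds

lemma tendsto_expKernel_atTop (hc : 0 < c) (ν : ℝ) :
    Filter.Tendsto (expKernel c ν) Filter.atTop (nhds 0) := by
  have h1 : Filter.Tendsto (fun t => exp (-(c * t))) Filter.atTop (nhds 0) :=
    tendsto_exp_neg_atTop_nhds_zero.comp (Filter.tendsto_id.const_mul_atTop hc)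
  have h2 : Filter.Tendsto (fun t => (1 - exp (-t)) ^ ν) Filter.atTop (nhds ((1 - 0) ^ ν)) :=
    (tendsto_exp_neg_atTop_nhds_zero.const_sub 1).rpow_const (by simp)
  have h := h1.mul h2
  rwa [zero_mul] at h

lemma image_exp_neg_Ioi : (fun t : ℝ => exp (-t)) '' Ioi 0 = Ioo 0 1 := by
  ext u
  constructor
  · rintro ⟨t, ht, rfl⟩
    exact ⟨exp_pos _, by simpa using ht⟩
  · rintro ⟨h0, h1⟩
    exact ⟨-log u, by simpa using log_neg h0 h1, by simp [exp_log h0]⟩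

lemma abs_deriv_smul_beta_kernel (c ν t : ℝ) :
    |(-exp (-t))| • (exp (-t) ^ (c - 1) * (1 - exp (-t)) ^ ν) = expKernel c ν t := by
  rw [abs_neg, abs_of_pos (exp_pos _), smul_eq_mul, ← mul_assoc, ← exp_mul, ← exp_add, expKernel]
  ring_nf

lemma hasDerivWithinAt_exp_neg (t : ℝ) (s : Set ℝ) :
    HasDerivWithinAt (fun t => exp (-t)) (-exp (-t)) s t := by
  simpa using (hasDerivAt_id t).neg.exp.hasDerivWithinAt

lemma ofReal_beta_integrand {x : ℝ} (hx : x ∈ Ioc (0 : ℝ) 1) (c ν : ℝ) :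
    (x : ℂ) ^ ((c : ℂ) - 1) * (1 - (x : ℂ)) ^ (((ν + 1 : ℝ) : ℂ) - 1)
      = ((x ^ (c - 1) * (1 - x) ^ ν : ℝ) : ℂ) := by
  rw [Complex.ofReal_mul, Complex.ofReal_cpow hx.1.le, Complex.ofReal_cpow (by linarith [hx.2])]
  push_cast
  ring_nf

lemma integrableOn_beta (hc : 0 < c) (hν : -1 < ν) :
    IntegrableOn (fun x : ℝ => x ^ (c - 1) * (1 - x) ^ ν) (Ioc 0 1) := by
  have h := Complex.betaIntegral_convergent (u := c) (v := (ν + 1 : ℝ)) (by simpa)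
    (by simp; linarith)
  rw [intervalIntegrable_iff_integrableOn_Ioc_of_le zero_le_one] at h
  have h' := ((integrableOn_congr_fun (fun x hx => ofReal_beta_integrand hx c ν)
    measurableSet_Ioc).1 h).re
  simpa [IntegrableOn] using h'

lemma integral_beta (hc : 0 < c) (hν : -1 < ν) :
    ∫ x in Ioc (0 : ℝ) 1, x ^ (c - 1) * (1 - x) ^ ν
      = Gamma c * Gamma (ν + 1) / Gamma (c + (ν + 1)) := by
  have h := Complex.betaIntegral_eq_Gamma_mul_div c (ν + 1 : ℝ) (by simpa) (by simp; linarith)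
  rw [Complex.betaIntegral, intervalIntegral.integral_of_le zero_le_one,
    setIntegral_congr_fun measurableSet_Ioc (fun x hx => ofReal_beta_integrand hx c ν),
    integral_complex_ofReal, ← Complex.ofReal_add, Complex.Gamma_ofReal, Complex.Gamma_ofReal,
    Complex.Gamma_ofReal] at h
  exact_mod_cast h

lemma integrableOn_expKernel (hc : 0 < c) (hν : -1 < ν) :
    IntegrableOn (expKernel c ν) (Ioi 0) := by
  have h := (integrableOn_beta hc hν).mono_set Ioo_subset_Ioc_self
  rw [← image_exp_neg_Ioi, integrableOn_image_iff_integrableOn_abs_deriv_smul measurableSet_Ioi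
    (fun t _ => hasDerivWithinAt_exp_neg t _)
    (fun x _ y _ h => neg_injective (exp_injective h))] at h
  simpa only [abs_deriv_smul_beta_kernel] using h

lemma integral_expKernel (hc : 0 < c) (hν : -1 < ν) :
    ∫ t in Ioi 0, expKernel c ν t = Gamma c * Gamma (ν + 1) / Gamma (c + (ν + 1)) := by
  rw [← integral_beta hc hν, integral_Ioc_eq_integral_Ioo, ← image_exp_neg_Ioi,
    integral_image_eq_integral_abs_deriv_smul measurableSet_Ioi
    (fun t _ => hasDerivWithinAt_exp_neg t _)
    (fun x _ y _ h => neg_injective (exp_injective h))]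
  simp only [abs_deriv_smul_beta_kernel]

lemma integrableOn_mul_expKernel (hc : 0 < c) (hν : -1 < ν) :
    IntegrableOn (fun t => t * expKernel c ν t) (Ioi 0) := by
  refine ((integrableOn_expKernel (half_pos hc) hν).const_mul (2 / c)).mono'
    (by fun_prop) ((ae_restrict_iff' measurableSet_Ioi).2 (.of_forall fun t (ht : 0 < t) => ?_))
  rw [norm_of_nonneg (mul_pos ht (expKernel_pos _ _ ht)).le]
  exact mul_expKernel_le_half hc ν ht

lemma integrableOn_mul_expKernel_succ (hc : 0 < c) (hν : -1 < ν) :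
    IntegrableOn (fun t => t * expKernel (c + 1) (ν - 1) t) (Ioi 0) := by
  refine (integrableOn_expKernel hc hν).mono'
    (by fun_prop) ((ae_restrict_iff' measurableSet_Ioi).2 (.of_forall fun t (ht : 0 < t) => ?_))
  rw [norm_of_nonneg (mul_pos ht (expKernel_pos _ _ ht)).le]
  exact mul_expKernel_le c ν ht

end ExpKernel

section Convexity

variable {t : ℝ}

lemma sq_mul_exp_neg_le (ht : 0 < t) : t ^ 2 * exp (-t) ≤ (1 - exp (-t)) ^ 2 := by
  have h := self_le_sinh_iff.2 (half_pos ht).le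
  rw [sinh_eq, le_div_iff₀ two_pos] at h
  have h2 : exp (-t) = exp (-(t / 2)) ^ 2 := by rw [← exp_nat_mul]; push_cast; ring_nf
  have h3 : exp (t / 2) * exp (-(t / 2)) = 1 := by rw [← exp_add]; simp
  have h4 : t * exp (-(t / 2)) ≤ 1 - exp (-t) := by
    have := mul_le_mul_of_nonneg_right h (exp_pos (-(t / 2))).le
    rw [sub_mul, h3] at this
    rw [h2]
    linarith
  calc t ^ 2 * exp (-t) = (t * exp (-(t / 2))) ^ 2 := by rw [h2]; ring
    _ ≤ _ := pow_le_pow_left₀ (by positivity) h4 2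

lemma hasDerivAt_exp_neg_div (ht : 0 < t) :
    HasDerivAt (fun t => exp (-t) / (1 - exp (-t))) (-exp (-t) / (1 - exp (-t)) ^ 2) t := by
  have h1 : HasDerivAt (fun t => exp (-t)) (-exp (-t)) t := by
    simpa using (hasDerivAt_id t).neg.exp
  refine (h1.div (h1.const_sub 1) (one_sub_exp_neg_pos_s9 ht).ne').congr_deriv ?_
  ring

lemma hasDerivAt_log_one_sub_exp_neg (ht : 0 < t) :
    HasDerivAt (fun t => log (1 - exp (-t))) (exp (-t) / (1 - exp (-t))) t := by
  have h1 : HasDerivAt (fun t => 1 - exp (-t)) (exp (-t)) t := by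
    simpa using (hasDerivAt_id t).neg.exp.const_sub 1
  exact h1.log (one_sub_exp_neg_pos_s9 ht).ne'

lemma tendsto_one_sub_exp_neg_div :
    Filter.Tendsto (fun t : ℝ => (1 - exp (-t)) / t) (nhdsWithin 0 (Ioi 0)) (nhds 1) := by
  have h : HasDerivAt (fun t => 1 - exp (-t)) 1 0 := by
    simpa using (hasDerivAt_id (0 : ℝ)).neg.exp.const_sub 1
  have h' := h.hasDerivWithinAt (s := Ioi 0)
  rw [hasDerivWithinAt_iff_tendsto_slope' (by simp)] at h'
  refine h'.congr fun t => ?_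
  simp [slope_def_field]

/-- The tangent line inequality at `t`, evaluated at `0`, for the convex function
`log ((1 - e^{-t}) / t)`. -/
lemma log_one_sub_exp_neg_le (ht : 0 < t) :
    log (1 - exp (-t)) - log t ≤ t * (exp (-t) / (1 - exp (-t))) - 1 := by
  let d : ℝ → ℝ := fun t => t * (exp (-t) / (1 - exp (-t))) - 1 - (log (1 - exp (-t)) - log t)
  have hd : ∀ t : ℝ, 0 < t → HasDerivAt d (1 / t - t * exp (-t) / (1 - exp (-t)) ^ 2) t := by
    intro t ht
    refine ((((hasDerivAt_id t).mul (hasDerivAt_exp_neg_div ht)).sub_const 1).sub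
      ((hasDerivAt_log_one_sub_exp_neg ht).sub (hasDerivAt_log ht.ne'))).congr_deriv ?_
    simp only [id]
    ring
  have hmono : MonotoneOn d (Ioi 0) := by
    refine monotoneOn_of_deriv_nonneg (convex_Ioi 0)
      (fun t ht => (hd t ht).continuousAt.continuousWithinAt)
      (fun t ht => (hd t (interior_subset ht)).differentiableAt.differentiableWithinAt)
      fun t ht => ?_
    have ht : 0 < t := interior_subset ht
    rw [(hd t ht).deriv, sub_nonneg, div_le_div_iff₀ (pow_pos (one_sub_exp_neg_pos_s9 ht) 2) ht]
    linarith [sq_mul_exp_neg_le ht]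
  have hlim : Filter.Tendsto d (nhdsWithin 0 (Ioi 0)) (nhds 0) := by
    have h1 := tendsto_one_sub_exp_neg_div
    have h2 : Filter.Tendsto (fun t : ℝ => exp (-t)) (nhdsWithin 0 (Ioi 0)) (nhds 1) := by
      have : ContinuousAt (fun t : ℝ => exp (-t)) 0 := by fun_prop
      simpa using this.tendsto.mono_left nhdsWithin_le_nhds
    have h3 := ((h2.mul (h1.inv₀ one_ne_zero)).sub_const 1).sub (h1.log one_ne_zero)
    rw [inv_one, mul_one, sub_self, log_one, sub_zero] at h3
    refine h3.congr' (Filter.eventually_of_mem self_mem_nhdsWithin fun t (ht : 0 < t) => ?_)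
    simp only [d]
    rw [log_div (one_sub_exp_neg_pos_s9 ht).ne' ht.ne', inv_div]
    ring
  have h0 : 0 ≤ d t := by
    refine le_of_tendsto hlim (Filter.eventually_of_mem
      (Ioc_mem_nhdsGT ht) fun s hs => hmono hs.1 ht hs.2)
  simp only [d] at h0
  linarith

end Convexity

/-- The first derivative of `expKernel b m`. -/
noncomputable def expKernelDeriv (b m t : ℝ) : ℝ :=
  -b * expKernel b m t + m * expKernel (b + 1) (m - 1) t

/-- The second derivative of `expKernel b m`. -/
noncomputable def expKernelDeriv₂ (b m t : ℝ) : ℝ :=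
  -b * expKernelDeriv b m t + m * expKernelDeriv (b + 1) (m - 1) t

section Density

variable {b m t : ℝ}

@[fun_prop]
lemma measurable_expKernelDeriv (b m : ℝ) : Measurable (expKernelDeriv b m) := by
  unfold expKernelDeriv
  fun_prop

@[fun_prop]
lemma measurable_expKernelDeriv₂ (b m : ℝ) : Measurable (expKernelDeriv₂ b m) := by
  unfold expKernelDeriv₂
  fun_prop

lemma hasDerivAt_expKernelDeriv (b m : ℝ) (ht : 0 < t) :
    HasDerivAt (expKernelDeriv b m) (expKernelDeriv₂ b m t) t :=
  ((hasDerivAt_expKernel b m ht).const_mul (-b)).add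
    ((hasDerivAt_expKernel (b + 1) (m - 1) ht).const_mul m)

lemma expKernelDeriv_eq (b m : ℝ) (ht : 0 < t) :
    expKernelDeriv b m t = expKernel b m t * (-b + m * (exp (-t) / (1 - exp (-t)))) := by
  have h := expKernel_succ b (m - 1) ht
  rw [sub_add_cancel] at h
  have := (one_sub_exp_neg_pos_s9 ht).ne'
  rw [expKernelDeriv, expKernel_succ_left, h]
  field_simp

lemma expKernelDeriv₂_eq (b m : ℝ) (ht : 0 < t) :
    expKernelDeriv₂ b m t = expKernel b m t * (-m * exp (-t) / (1 - exp (-t)) ^ 2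
      + (-b + m * (exp (-t) / (1 - exp (-t)))) ^ 2) := by
  have h := expKernel_succ b (m - 1) ht
  rw [sub_add_cancel] at h
  have := (one_sub_exp_neg_pos_s9 ht).ne'
  rw [expKernelDeriv₂, expKernelDeriv_eq b m ht, expKernelDeriv_eq _ _ ht, expKernel_succ_left, h]
  field_simp
  ring

/-- The density whose Laplace transform is a multiple of `x^{1-λ} L'(x)`, with `m = λ - 1`. -/
noncomputable def bernsteinDensity (b m t : ℝ) : ℝ :=
  m * t ^ (m - 1) + (t * expKernelDeriv₂ b m t - m * expKernelDeriv b m t)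

@[fun_prop]
lemma measurable_bernsteinDensity (b m : ℝ) : Measurable (bernsteinDensity b m) := by
  unfold bernsteinDensity
  fun_prop

lemma bernsteinDensity_nonneg (b : ℝ) (hm : 0 ≤ m) (ht : 0 < t) :
    0 ≤ bernsteinDensity b m t := by
  have hs := one_sub_exp_neg_pos_s9 ht
  have hq := log_one_sub_exp_neg_le ht
  have hQ := sq_mul_exp_neg_le ht
  set s := 1 - exp (-t) with hs_def
  set P := t * (-b + m * (exp (-t) / s)) with hP
  set Q := t ^ 2 * exp (-t) / s ^ 2 with hQ_def
  have hQ1 : Q ≤ 1 := (div_le_one (by positivity)).2 hQ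
  have hK : expKernel b m t * (1 - P + m) ≤ t ^ m := by
    have h1 : expKernel b m t = exp (-(b * t) + m * log s) := by
      rw [expKernel, ← hs_def, rpow_def_of_pos hs, ← exp_add, mul_comm m]
    have h2 : t ^ m = expKernel b m t * exp (b * t - m * (log s - log t)) := by
      rw [h1, rpow_def_of_pos ht, ← exp_add]
      ring_nf
    rw [h2]
    refine mul_le_mul_of_nonneg_left ?_ (expKernel_pos b m ht).le
    have h3 := add_one_le_exp (b * t - m * (log s - log t))
    have h4 := mul_le_mul_of_nonneg_left hq hm
    rw [hP]
    linarith
  have key : t * bernsteinDensity b m t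
      = m * t ^ m + expKernel b m t * (-m * P - m * Q + P ^ 2) := by
    rw [bernsteinDensity, expKernelDeriv_eq b m ht, expKernelDeriv₂_eq b m ht, ← hs_def, hP, hQ_def,
      rpow_sub_one ht.ne']
    field_simp
    ring
  refine nonneg_of_mul_nonneg_right (?_ : 0 ≤ t * _) ht
  have h5 : 0 ≤ expKernel b m t * ((P - m) ^ 2 + m * (1 - Q)) :=
    mul_nonneg (expKernel_pos b m ht).le
      (add_nonneg (sq_nonneg _) (mul_nonneg hm (sub_nonneg.2 hQ1)))
  rw [key]
  nlinarith [mul_le_mul_of_nonneg_left hK hm]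

lemma integrableOn_rpow_mul_exp (hm : 0 < m) {x : ℝ} (hx : 0 < x) :
    IntegrableOn (fun t => t ^ (m - 1) * exp (x * -t)) (Ioi 0) := by
  simpa using integrableOn_rpow_mul_exp_neg_mul_rpow (s := m - 1) (by linarith) one_pos hx

lemma integrableOn_expKernelDeriv (hb : 0 < b) (hm : 0 < m) {x : ℝ} (hx : 0 < x) :
    IntegrableOn (fun t => expKernelDeriv b m t * exp (x * -t)) (Ioi 0) := by
  simp only [expKernelDeriv, add_mul, mul_assoc, expKernel_mul_exp]
  exact ((integrableOn_expKernel (by linarith) (by linarith)).const_mul _).add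
    ((integrableOn_expKernel (by linarith) (by linarith)).const_mul _)

lemma integrableOn_mul_expKernelDeriv₂ (hb : 0 < b) (hm : 0 < m) {x : ℝ} (hx : 0 < x) :
    IntegrableOn (fun t => t * expKernelDeriv₂ b m t * exp (x * -t)) (Ioi 0) := by
  have h0 := integrableOn_mul_expKernel (c := b + x) (ν := m) (by linarith) (by linarith)
  have h1 := integrableOn_mul_expKernel (c := b + 1 + x) (ν := m - 1) (by linarith) (by linarith)
  have h2 := integrableOn_mul_expKernel_succ (c := b + 1 + x) (ν := m - 1) (by linarith)
    (by linarith)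
  rw [show b + 1 + x + 1 = b + 1 + 1 + x by ring] at h2
  refine IntegrableOn.congr_fun (((h0.const_mul (b ^ 2)).add
    (h1.const_mul (-(b * m) - m * (b + 1)))).add (h2.const_mul (m * (m - 1))))
    (fun t _ => ?_) measurableSet_Ioi
  simp only [← expKernel_mul_exp, expKernelDeriv₂, expKernelDeriv, Pi.add_apply]
  ring

lemma integrableOn_mul_expKernelDeriv₂_sub (hb : 0 < b) (hm : 0 < m) {x : ℝ} (hx : 0 < x) :
    IntegrableOn (fun t => (t * expKernelDeriv₂ b m t - m * expKernelDeriv b m t) * exp (x * -t))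
      (Ioi 0) := by
  refine IntegrableOn.congr_fun ((integrableOn_mul_expKernelDeriv₂ hb hm hx).sub
    ((integrableOn_expKernelDeriv hb hm hx).const_mul m)) (fun t _ => ?_) measurableSet_Ioi
  simp only [Pi.sub_apply]
  ring

lemma integrableOn_bernsteinDensity (hb : 0 < b) (hm : 0 < m) {x : ℝ} (hx : 0 < x) :
    IntegrableOn (fun t => bernsteinDensity b m t * exp (x * -t)) (Ioi 0) := by
  refine IntegrableOn.congr_fun (((integrableOn_rpow_mul_exp hm hx).const_mul m).add
    (integrableOn_mul_expKernelDeriv₂_sub hb hm hx)) (fun t _ => ?_) measurableSet_Ioi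
  simp only [bernsteinDensity, Pi.add_apply]
  ring

lemma tendsto_mul_expKernel_succ {l : Filter ℝ} (hl : ∀ᶠ t in l, 0 < t) {c ν : ℝ}
    (h : Filter.Tendsto (expKernel c ν) l (nhds 0)) :
    Filter.Tendsto (fun t => t * expKernel (c + 1) (ν - 1) t) l (nhds 0) :=
  squeeze_zero' (hl.mono fun _ ht => (mul_pos ht (expKernel_pos _ _ ht)).le)
    (hl.mono fun _ ht => mul_expKernel_le _ _ ht) h

lemma tendsto_mul_expKernel {l : Filter ℝ} (hl : ∀ᶠ t in l, 0 < t) {c ν : ℝ} (hc : 0 < c)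
    (h : Filter.Tendsto (expKernel (c / 2) ν) l (nhds 0)) :
    Filter.Tendsto (fun t => t * expKernel c ν t) l (nhds 0) :=
  squeeze_zero' (hl.mono fun _ ht => (mul_pos ht (expKernel_pos _ _ ht)).le)
    (hl.mono fun _ ht => mul_expKernel_le_half hc _ ht) (by simpa using h.const_mul (2 / c))

/-- Integration by parts for the Laplace transform of `t h'' - m h'`, where `h = expKernel b m`. -/
lemma integral_mul_expKernelDeriv₂_sub (hb : 0 < b) (hm : 0 < m) {x : ℝ} (hx : 0 < x) :
    ∫ t in Ioi 0, (t * expKernelDeriv₂ b m t - m * expKernelDeriv b m t) * exp (x * -t)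
      = x ^ 2 * (∫ t in Ioi 0, t * expKernel (b + x) m t)
        - (m + 2) * x * ∫ t in Ioi 0, expKernel (b + x) m t := by
  have hi0 := integrableOn_expKernel (c := b + x) (ν := m) (by linarith) (by linarith)
  have hi1 := integrableOn_mul_expKernel (c := b + x) (ν := m) (by linarith) (by linarith)
  have hi2 := integrableOn_mul_expKernelDeriv₂_sub hb hm hx
  let G : ℝ → ℝ := fun t => (x - b) * (t * expKernel (b + x) m t)
    + m * (t * expKernel (b + x + 1) (m - 1) t) - (m + 1) * expKernel (b + x) m t
  have hG : ∀ t ∈ Ioi (0 : ℝ), HasDerivAt G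
      ((t * expKernelDeriv₂ b m t - m * expKernelDeriv b m t) * exp (x * -t)
        + ((m + 2) * x * expKernel (b + x) m t - x ^ 2 * (t * expKernel (b + x) m t))) t := by
    intro t ht
    have e0 := hasDerivAt_expKernel (b + x) m ht
    have e1 := hasDerivAt_expKernel (b + x + 1) (m - 1) ht
    refine (((((hasDerivAt_id t).mul e0).const_mul (x - b)).add
      (((hasDerivAt_id t).mul e1).const_mul m)).sub (e0.const_mul (m + 1))).congr_deriv ?_
    simp only [id, expKernelDeriv₂, expKernelDeriv, show b + x + 1 = b + 1 + x by ring,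
      show b + 1 + x + 1 = b + 1 + 1 + x by ring, ← expKernel_mul_exp]
    ring
  have hGlim : ∀ l : Filter ℝ, (∀ᶠ t in l, 0 < t) →
      (∀ c, 0 < c → Filter.Tendsto (expKernel c m) l (nhds 0)) →
      Filter.Tendsto G l (nhds 0) := by
    intro l hl h
    have := (((tendsto_mul_expKernel hl (by linarith : 0 < b + x)
      (h _ (by linarith))).const_mul (x - b)).add
      ((tendsto_mul_expKernel_succ hl (h (b + x) (by linarith))).const_mul m)).sub
      ((h (b + x) (by linarith)).const_mul (m + 1))
    simpa using this
  have hG0 : ContinuousWithinAt G (Ici 0) 0 := by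
    rw [← continuousWithinAt_Ioi_iff_Ici, ContinuousWithinAt,
      show G 0 = 0 by simp [G, expKernel, hm.ne']]
    exact hGlim _ self_mem_nhdsWithin fun c _ => tendsto_expKernel_zero c hm
  have hGtop := hGlim _ (Filter.eventually_gt_atTop 0) fun c hc => tendsto_expKernel_atTop hc m
  have hr : IntegrableOn (fun t => (m + 2) * x * expKernel (b + x) m t
      - x ^ 2 * (t * expKernel (b + x) m t)) (Ioi 0) :=
    (hi0.const_mul ((m + 2) * x)).sub (hi1.const_mul (x ^ 2))
  have h := integral_Ioi_of_hasDerivAt_of_tendsto hG0 hG (hi2.add hr) hGtop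
  rw [integral_add hi2 hr, integral_sub (hi0.const_mul _) (hi1.const_mul _), integral_const_mul,
    integral_const_mul, show G 0 = 0 by simp [G, expKernel, hm.ne']] at h
  linarith

lemma integral_bernsteinDensity (hb : 0 < b) (hm : 0 < m) {x : ℝ} (hx : 0 < x) :
    ∫ t in Ioi 0, bernsteinDensity b m t * exp (x * -t)
      = Gamma (m + 1) * x ^ (-m) + (x ^ 2 * (∫ t in Ioi 0, t * expKernel (b + x) m t)
        - (m + 2) * x * ∫ t in Ioi 0, expKernel (b + x) m t) := by
  have h1 : ∫ t in Ioi 0, t ^ (m - 1) * exp (x * -t) = x ^ (-m) * Gamma m := by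
    have := integral_rpow_mul_exp_neg_mul_Ioi hm hx
    rw [one_div, inv_rpow hx.le, ← rpow_neg hx.le] at this
    rw [← this]
    simp only [mul_neg]
  rw [← integral_mul_expKernelDeriv₂_sub hb hm hx, Gamma_add_one hm.ne', mul_right_comm, mul_assoc,
    ← h1, ← integral_const_mul,
    ← integral_add ((integrableOn_rpow_mul_exp hm hx).const_mul m)
      (integrableOn_mul_expKernelDeriv₂_sub hb hm hx)]
  refine setIntegral_congr_fun measurableSet_Ioi fun t _ => ?_
  simp only [bernsteinDensity]
  ring

lemma hasDerivAt_integral_expKernel (hb : 0 < b) (hm : 0 < m) {x : ℝ} (hx : 0 < x) :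
    HasDerivAt (fun x => ∫ t in Ioi 0, expKernel (b + x) m t)
      (-∫ t in Ioi 0, t * expKernel (b + x) m t) x := by
  have h := hasDerivAt_laplace (measurable_expKernel b m)
    (fun t ht => (expKernel_pos b m ht).le) (fun y hy => by
      simp only [expKernel_mul_exp]
      exact integrableOn_expKernel (by linarith) (by linarith)) hx
  simp only [expKernel_mul_exp] at h
  refine h.congr_deriv ?_
  rw [← integral_neg]
  refine setIntegral_congr_fun measurableSet_Ioi fun t _ => ?_
  simp only [← expKernel_mul_exp]
  ring

end Density

lemma rpow_mul_deriv_L {a b x : ℝ} (hb : 0 < b) (hab : 1 < a - b) (hx : 0 < x) :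
    x ^ (1 - (a - b)) * deriv (L a b) x
      = ∫ t in Ioi 0, (Gamma (a - b))⁻¹ * bernsteinDensity b (a - b - 1) t * exp (x * -t) := by
  have hm : 0 < a - b - 1 := by linarith
  have hΓ : Gamma (a - b) ≠ 0 := (Gamma_pos_of_pos (by linarith)).ne'
  simp only [mul_assoc]
  rw [integral_const_mul, integral_bernsteinDensity hb hm hx, sub_add_cancel]
  have hL : ∀ y : ℝ, 0 < y → L a b y = y - y ^ (a - b + 1)
      * ((Gamma (a - b))⁻¹ * ∫ t in Ioi 0, expKernel (b + y) (a - b - 1) t) := by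
    intro y hy
    rw [integral_expKernel (by linarith) (by linarith), L, M, sub_add_cancel,
      rpow_add_one hy.ne', show b + y + (a - b) = y + a by ring, add_comm b y]
    have : Gamma (y + a) ≠ 0 := (Gamma_pos_of_pos (by linarith)).ne'
    field_simp
  have hd := (hasDerivAt_id x).sub ((hasDerivAt_rpow_const (p := a - b + 1) (Or.inl hx.ne')).mul
    ((hasDerivAt_integral_expKernel hb hm hx).const_mul (Gamma (a - b))⁻¹))
  rw [(hd.congr_of_eventuallyEq (Filter.eventually_of_mem (Ioi_mem_nhds hx) hL)).deriv]
  have h1 : x ^ (-(a - b - 1)) = x ^ (1 - (a - b)) := by ring_nf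
  have h2 : x ^ (1 - (a - b)) * x ^ (a - b) = x := by rw [← rpow_add hx]; simp
  rw [h1, add_sub_cancel_right, rpow_add_one hx.ne']
  generalize x ^ (1 - (a - b)) = p at *
  generalize x ^ (a - b) = q at *
  generalize ∫ t in Ioi 0, t * expKernel (b + x) (a - b - 1) t = J
  generalize ∫ t in Ioi 0, expKernel (b + x) (a - b - 1) t = I
  field_simp
  linear_combination (x * J - (a - b + 1) * I) * h2

/-- `L_{a,b} ∈ B_{a-b}`. -/
theorem L_mem_genBernstein (a b : ℝ) (hb : 0 < b) (hba : b < a) (ha : 1 < a)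
    (hab : 1 < a - b) :
    CompletelyMonotonicOn (fun x => x ^ (1 - (a - b)) * deriv (L a b) x) := by
  have hΓ : 0 < Gamma (a - b) := Gamma_pos_of_pos (by linarith)
  refine CompletelyMonotonicOn.of_laplace
    (w := fun t => (Gamma (a - b))⁻¹ * bernsteinDensity b (a - b - 1) t) (by fun_prop)
    (fun t ht => mul_nonneg (inv_pos.2 hΓ).le (bernsteinDensity_nonneg b (by linarith) ht))
    (fun x hx => ?_) (fun x hx => rpow_mul_deriv_L hb hab hx)
  simp only [mul_assoc]
  exact (integrableOn_bernsteinDensity hb (by linarith) hx).const_mul _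
end

section
/- Let λ₁, λ₂ > 0 and α₁ < λ₁+1, α₂ < λ₂+1, and let f₁ ∈ T_{λ₁,α₁} and f₂ ∈ T_{λ₂,α₂} be higher order Thorin-Bernstein functions with limits f₁(0), f₂(0) at 0⁺. Then the function x ↦ (f₁(x)-f₁(0))(f₂(x)-f₂(0)) belongs to T_{λ₁+λ₂, α₁+α₂-1}; equivalently, x ↦ x^{1-λ₁-λ₂} · d/dx [(f₁(x)-f₁(0))(f₂(x)-f₂(0))] belongs to the generalized Stieltjes class S_{λ₁+λ₂+2-α₁-α₂}. -/
open MeasureTheory Real Set Filter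

open scoped ENNReal

/-- The `ℝ≥0∞`-valued functions given on `(0, ∞)` by a Stieltjes-type integral of order `β`, with
no finiteness requirement. -/
def IsLStieltjes (β : ℝ) (G : ℝ → ℝ≥0∞) : Prop :=
  ∃ (μ : Measure ℝ) (c : ℝ≥0∞), SFinite μ ∧ (∀ᵐ t ∂μ, 0 ≤ t) ∧
    ∀ x : ℝ, 0 < x → G x = (∫⁻ t, ENNReal.ofReal ((x + t) ^ (-β)) ∂μ) + c

lemma IsGenStieltjes.nonneg {β : ℝ} {g : ℝ → ℝ} (h : IsGenStieltjes β g) {x : ℝ} (hx : 0 < x) :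
    0 ≤ g x := by
  obtain ⟨μ, c, hμ, hc, h⟩ := h
  have hpos : ∀ᵐ t ∂μ, (0 : ℝ) ≤ t := by
    rw [ae_iff]; simpa [Set.Iio] using hμ
  rw [(h x hx).2]
  refine add_nonneg (integral_nonneg_of_ae ?_) hc
  filter_upwards [hpos] with t ht
  exact rpow_nonneg (by linarith) _

lemma IsGenStieltjes.isLStieltjes {β : ℝ} {g : ℝ → ℝ} (h : IsGenStieltjes β g) :
    IsLStieltjes β (fun x => ENNReal.ofReal (g x)) := by
  obtain ⟨μ, c, hμ, hc, h⟩ := h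
  have hpos : ∀ᵐ t ∂μ, (0 : ℝ) ≤ t := by
    rw [ae_iff]; simpa [Set.Iio] using hμ
  refine ⟨μ, ENNReal.ofReal c, ?_, hpos, fun x hx => ?_⟩
  · let f : ℝ → ℝ≥0∞ := fun t => ENNReal.ofReal ((1 + t) ^ (-β))
    have hf : Measurable f := by fun_prop
    have hfin : ∫⁻ t, f t ∂μ ≠ ∞ := (h 1 one_pos).1.lintegral_lt_top.ne
    have : IsFiniteMeasure (μ.withDensity f) := isFiniteMeasure_withDensity hfin
    have hinv : (μ.withDensity f).withDensity (fun t => (f t)⁻¹) = μ := by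
      refine withDensity_inv_same hf ?_ ?_
      · filter_upwards [hpos] with t ht
        have : 0 < (1 + t) ^ (-β) := rpow_pos_of_pos (by linarith) _
        simpa [f] using this
      · exact ae_of_all _ fun t => ENNReal.ofReal_ne_top
    rw [← hinv]
    infer_instance
  · have hnn : 0 ≤ᵐ[μ] fun t => (x + t) ^ (-β) := by
      filter_upwards [hpos] with t ht
      exact rpow_nonneg (by linarith) _
    dsimp only
    rw [(h x hx).2, ENNReal.ofReal_add (integral_nonneg_of_ae hnn) hc,
      ofReal_integral_eq_lintegral_ofReal (h x hx).1 hnn]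

lemma IsLStieltjes.isGenStieltjes {β : ℝ} {g : ℝ → ℝ} (hg : ∀ x, 0 < x → 0 ≤ g x)
    (h : IsLStieltjes β (fun x => ENNReal.ofReal (g x))) : IsGenStieltjes β g := by
  obtain ⟨μ, c, -, hpos, h⟩ := h
  refine ⟨μ, c.toReal, ?_, ENNReal.toReal_nonneg, fun x hx => ?_⟩
  · rw [ae_iff] at hpos; simpa [Set.Iio] using hpos
  · have hx' : ENNReal.ofReal (g x) = _ := h x hx
    have hne := ENNReal.add_ne_top.1 (hx' ▸ ENNReal.ofReal_ne_top)
    have hnn : 0 ≤ᵐ[μ] fun t => (x + t) ^ (-β) := by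
      filter_upwards [hpos] with t ht
      exact rpow_nonneg (by linarith) _
    have hm : AEStronglyMeasurable (fun t => (x + t) ^ (-β)) μ :=
      Measurable.aestronglyMeasurable (by fun_prop)
    refine ⟨⟨hm, (hasFiniteIntegral_iff_ofReal hnn).2 hne.1.lt_top⟩, ?_⟩
    rw [integral_eq_lintegral_of_nonneg_ae hnn hm, ← ENNReal.toReal_add hne.1 hne.2, ← hx',
      ENNReal.toReal_ofReal (hg x hx)]

lemma IsLStieltjes.congr {β : ℝ} {G H : ℝ → ℝ≥0∞} (h : IsLStieltjes β G)
    (hGH : ∀ x, 0 < x → H x = G x) : IsLStieltjes β H := by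
  obtain ⟨μ, c, hs, hpos, h⟩ := h
  exact ⟨μ, c, hs, hpos, fun x hx => (hGH x hx).trans (h x hx)⟩

lemma isLStieltjes_const (β : ℝ) (c : ℝ≥0∞) : IsLStieltjes β (fun _ => c) :=
  ⟨0, c, inferInstance, by simp, by simp⟩

lemma IsLStieltjes.add {β : ℝ} {G H : ℝ → ℝ≥0∞} (hG : IsLStieltjes β G) (hH : IsLStieltjes β H) :
    IsLStieltjes β (fun x => G x + H x) := by
  obtain ⟨μ, c, hs, hpos, h⟩ := hG
  obtain ⟨μ', c', hs', hpos', h'⟩ := hH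
  refine ⟨μ + μ', c + c', inferInstance, ae_add_measure_iff.2 ⟨hpos, hpos'⟩, fun x hx => ?_⟩
  dsimp only
  rw [h x hx, h' x hx, lintegral_add_measure]
  ring

lemma isLStieltjes_lintegral {Ω : Type*} [MeasurableSpace Ω] (ν : Measure Ω) [SFinite ν] (β : ℝ)
    {w : Ω → ℝ≥0∞} (hw : Measurable w) {T : Ω → ℝ} (hT : Measurable T) (hT0 : ∀ ω, 0 ≤ T ω) :
    IsLStieltjes β (fun x => ∫⁻ ω, w ω * ENNReal.ofReal ((x + T ω) ^ (-β)) ∂ν) := by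
  refine ⟨(ν.withDensity w).map T, 0, inferInstance, ?_, fun x _ => ?_⟩
  · exact (ae_map_iff hT.aemeasurable measurableSet_Ici).2 (ae_of_all _ hT0)
  · rw [lintegral_map (by fun_prop) hT, lintegral_withDensity_eq_lintegral_mul _ hw (by fun_prop),
      add_zero]
    rfl

lemma lintegral_comp_mul_left_real {a : ℝ} (ha : 0 < a) {φ : ℝ → ℝ≥0∞} (hφ : Measurable φ) :
    ∫⁻ x, φ x = ENNReal.ofReal a * ∫⁻ x, φ (a * x) := by
  conv_lhs => rw [← Real.smul_map_volume_mul_left ha.ne']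
  rw [lintegral_smul_measure, lintegral_map hφ (by fun_prop), abs_of_pos ha, smul_eq_mul]

/-- The Feynman parametrization of `A ^ (-a) * B ^ (-b)`, with an unspecified constant. -/
lemma exists_lintegral_feynman {a b : ℝ} (ha : 0 < a) (hb : 0 < b) :
    ∃ K : ℝ≥0∞, K ≠ 0 ∧ K ≠ ∞ ∧ ∀ A B : ℝ, 0 < A → 0 < B →
      ∫⁻ v in Ioi (0 : ℝ), ENNReal.ofReal (v ^ (a - 1) * (v * A + B) ^ (-(a + b))) =
        K * ENNReal.ofReal (A ^ (-a) * B ^ (-b)) := by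
  refine ⟨∫⁻ v in Ioi (0 : ℝ), ENNReal.ofReal (v ^ (a - 1) * (v + 1) ^ (-(a + b))), ?_, ?_, ?_⟩
  · refine ((setLIntegral_pos_iff (by fun_prop)).2 ?_).ne'
    refine lt_of_lt_of_le (b := volume (Ioi (0 : ℝ))) (by simp) (measure_mono fun v hv => ?_)
    have hv : 0 < v := hv
    refine ⟨?_, hv⟩
    have : 0 < v ^ (a - 1) * (v + 1) ^ (-(a + b)) := by positivity
    simpa using this
  · rw [← Ioc_union_Ioi_eq_Ioi zero_le_one,
      lintegral_union measurableSet_Ioi (Set.disjoint_left.2 fun x hx hx' => not_lt.2 hx.2 hx')]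
    refine ENNReal.add_ne_top.2 ⟨?_, ?_⟩
    · have hi : IntegrableOn (fun v : ℝ => v ^ (a - 1)) (Ioc 0 1) :=
        (intervalIntegrable_iff_integrableOn_Ioc_of_le zero_le_one).1
          (intervalIntegral.intervalIntegrable_rpow' (by linarith))
      refine ne_top_of_le_ne_top hi.lintegral_lt_top.ne
        (setLIntegral_mono (by fun_prop) fun v hv => ENNReal.ofReal_le_ofReal ?_)
      have hv0 : 0 < v := hv.1
      exact mul_le_of_le_one_right (by positivity)
        (rpow_le_one_of_one_le_of_nonpos (by linarith) (by linarith))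
    · have hi : IntegrableOn (fun v : ℝ => v ^ (-b - 1)) (Ioi 1) :=
        integrableOn_Ioi_rpow_of_lt (by linarith) one_pos
      refine ne_top_of_le_ne_top hi.lintegral_lt_top.ne
        (setLIntegral_mono (by fun_prop) fun v hv => ENNReal.ofReal_le_ofReal ?_)
      have hv0 : 0 < v := one_pos.trans hv
      have : v ^ (-b - 1) = v ^ (a - 1) * v ^ (-(a + b)) := by
        rw [← rpow_add hv0]; congr 1; ring
      rw [this]
      exact mul_le_mul_of_nonneg_left
        (rpow_le_rpow_of_nonpos hv0 (by linarith) (by linarith)) (by positivity)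
  · intro A B hA hB
    have hr : 0 < B / A := div_pos hB hA
    rw [← lintegral_indicator measurableSet_Ioi, ← lintegral_indicator measurableSet_Ioi,
      lintegral_comp_mul_left_real hr (Measurable.indicator (by fun_prop) measurableSet_Ioi),
      mul_comm, ← lintegral_mul_const' _ _ ENNReal.ofReal_ne_top,
      ← lintegral_mul_const' _ _ ENNReal.ofReal_ne_top]
    refine lintegral_congr fun v => ?_
    by_cases hv : 0 < v
    · rw [indicator_of_mem (by exact mul_pos hr hv), indicator_of_mem (by exact hv),
        ← ENNReal.ofReal_mul (by positivity), ← ENNReal.ofReal_mul (by positivity)]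
      congr 1
      have h1 : B / A * v * A + B = B * (v + 1) := by field_simp
      rw [h1, mul_rpow hr.le hv.le, mul_rpow hB.le (by linarith), div_rpow hB.le hA.le,
        rpow_sub hB, rpow_sub hA, rpow_neg hB.le (a + b), rpow_add hB, rpow_neg hA.le,
        rpow_neg hB.le b, rpow_one, rpow_one]
      field_simp
    · rw [indicator_of_notMem (by simpa [hr] using hv), indicator_of_notMem (by exact hv)]
      simp

lemma isLStieltjes_const_mul_lintegral {a b : ℝ} (ha : 0 < a) (hb : 0 < b) (μ : Measure ℝ)
    [SFinite μ] (hμ : ∀ᵐ t ∂μ, 0 ≤ t) (c : ℝ≥0∞) :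
    IsLStieltjes (a + b) (fun x => c * ∫⁻ t, ENNReal.ofReal ((x + t) ^ (-b)) ∂μ) := by
  obtain ⟨K, hK0, hK, h⟩ := exists_lintegral_feynman ha hb
  refine (isLStieltjes_lintegral (μ.prod (volume.restrict (Ioi (0 : ℝ)))) (a + b)
    (w := fun p => c * K⁻¹ * ENNReal.ofReal (p.2 ^ (a - 1))) (by fun_prop)
    (T := fun p => |p.1| + |p.2|) (by fun_prop) (fun p => by positivity)).congr fun x hx => ?_
  rw [lintegral_prod _ (by fun_prop), ← lintegral_const_mul _ (by fun_prop)]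
  refine lintegral_congr_ae ?_
  filter_upwards [hμ] with t ht
  have hxt : 0 < x + t := by linarith
  have h1 := h 1 (x + t) one_pos hxt
  rw [one_rpow, one_mul] at h1
  rw [← one_mul (ENNReal.ofReal ((x + t) ^ (-b))), ← ENNReal.inv_mul_cancel hK0 hK, mul_assoc K⁻¹,
    ← h1, ← mul_assoc, ← lintegral_const_mul _ (by fun_prop)]
  refine setLIntegral_congr_fun measurableSet_Ioi fun v hv => ?_
  have hv : 0 < v := hv
  rw [ENNReal.ofReal_mul (by positivity), abs_of_nonneg ht, abs_of_pos hv, ← mul_assoc]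
  congr 3
  ring

lemma isLStieltjes_lintegral_mul_lintegral {a b : ℝ} (ha : 0 < a) (hb : 0 < b) (μ ν : Measure ℝ)
    [SFinite μ] [SFinite ν] (hμ : ∀ᵐ t ∂μ, 0 ≤ t) (hν : ∀ᵐ t ∂ν, 0 ≤ t) :
    IsLStieltjes (a + b) (fun x => (∫⁻ s, ENNReal.ofReal ((x + s) ^ (-a)) ∂μ) *
      ∫⁻ t, ENNReal.ofReal ((x + t) ^ (-b)) ∂ν) := by
  obtain ⟨K, hK0, hK, h⟩ := exists_lintegral_feynman ha hb
  refine (isLStieltjes_lintegral (μ.prod (ν.prod (volume.restrict (Ioi (0 : ℝ))))) (a + b)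
    (w := fun p => K⁻¹ * ENNReal.ofReal (p.2.2 ^ (a - 1) * (p.2.2 + 1) ^ (-(a + b))))
    (by fun_prop)
    (T := fun p => (|p.2.2| * |p.1| + |p.2.1|) / (|p.2.2| + 1)) (by fun_prop)
    (fun p => by positivity)).congr fun x hx => ?_
  rw [lintegral_prod _ (by fun_prop), ← lintegral_mul_const _ (by fun_prop)]
  refine lintegral_congr_ae ?_
  filter_upwards [hμ] with s hs
  rw [lintegral_prod _ (by fun_prop), ← lintegral_const_mul _ (by fun_prop)]
  refine lintegral_congr_ae ?_
  filter_upwards [hν] with t ht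
  have hxs : 0 < x + s := by linarith
  have hxt : 0 < x + t := by linarith
  have h1 := h (x + s) (x + t) hxs hxt
  rw [← ENNReal.ofReal_mul (by positivity),
    ← one_mul (ENNReal.ofReal ((x + s) ^ (-a) * (x + t) ^ (-b))), ← ENNReal.inv_mul_cancel hK0 hK,
    mul_assoc K⁻¹, ← h1, ← lintegral_const_mul _ (by fun_prop)]
  refine setLIntegral_congr_fun measurableSet_Ioi fun v hv => ?_
  have hv : 0 < v := hv
  rw [abs_of_nonneg ht, abs_of_nonneg hs, abs_of_pos hv, mul_assoc K⁻¹,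
    ← ENNReal.ofReal_mul (by positivity), mul_assoc (v ^ (a - 1)),
    ← mul_rpow (by positivity) (by positivity)]
  congr 4
  field_simp
  ring

lemma IsLStieltjes.mul {a b : ℝ} (ha : 0 < a) (hb : 0 < b) {G H : ℝ → ℝ≥0∞}
    (hG : IsLStieltjes a G) (hH : IsLStieltjes b H) :
    IsLStieltjes (a + b) (fun x => G x * H x) := by
  obtain ⟨μ, c, hs, hpos, h⟩ := hG
  obtain ⟨ν, d, hs', hpos', h'⟩ := hH
  have hd := isLStieltjes_const_mul_lintegral hb ha μ hpos d
  rw [add_comm b a] at hd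
  refine ((((isLStieltjes_lintegral_mul_lintegral ha hb μ ν hpos hpos').add hd).add
    (isLStieltjes_const_mul_lintegral ha hb ν hpos' c)).add
    (isLStieltjes_const (a + b) (c * d))).congr fun x hx => ?_
  rw [h x hx, h' x hx]
  ring

lemma IsLStieltjes.lintegral_comp_mul {β l : ℝ} {G : ℝ → ℝ≥0∞} (hG : IsLStieltjes β G) :
    IsLStieltjes β (fun x => ∫⁻ u in Ioc (0 : ℝ) 1, ENNReal.ofReal (u ^ (l - 1)) * G (x * u)) := by
  obtain ⟨μ, c, hs, hpos, h⟩ := hG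
  refine ((isLStieltjes_lintegral ((volume.restrict (Ioc (0 : ℝ) 1)).prod μ) β
    (w := fun p => ENNReal.ofReal (p.1 ^ (l - 1) * p.1 ^ (-β))) (by fun_prop)
    (T := fun p => |p.2| / |p.1|) (by fun_prop) (fun p => by positivity)).add
    (isLStieltjes_const β (∫⁻ u in Ioc (0 : ℝ) 1, ENNReal.ofReal (u ^ (l - 1)) * c))).congr
    fun x hx => ?_
  rw [lintegral_prod _ (by fun_prop), ← lintegral_add_right _ (by fun_prop)]
  refine setLIntegral_congr_fun measurableSet_Ioc fun u hu => ?_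
  have hu : 0 < u := hu.1
  dsimp only
  rw [h _ (mul_pos hx hu), mul_add, ← lintegral_const_mul _ (by fun_prop)]
  congr 1
  refine lintegral_congr_ae ?_
  filter_upwards [hpos] with t ht
  rw [abs_of_nonneg ht, abs_of_pos hu, ← ENNReal.ofReal_mul (by positivity),
    ← ENNReal.ofReal_mul (by positivity), mul_assoc, ← mul_rpow (by positivity) (by positivity)]
  congr 3
  field_simp

lemma sub_eq_lintegral_of_tendsto {f : ℝ → ℝ} {c x : ℝ} (hx : 0 < x)
    (hf : ∀ y, 0 < y → DifferentiableAt ℝ f y) (hf' : ∀ y, 0 < y → 0 ≤ deriv f y)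
    (hc : Tendsto f (nhdsWithin 0 (Ioi 0)) (nhds c)) :
    0 ≤ f x - c ∧ ENNReal.ofReal (f x - c) = ∫⁻ s in Ioc 0 x, ENNReal.ofReal (deriv f s) := by
  let F := Function.update f 0 c
  have hF : ∀ y, 0 < y → F =ᶠ[nhds y] f := fun y hy => by
    filter_upwards [isOpen_ne.mem_nhds hy.ne'] with z hz
    exact Function.update_of_ne hz _ _
  have hcont : ContinuousOn F (Icc 0 x) := by
    intro y hy
    rcases hy.1.eq_or_lt with rfl | hy0
    · refine (continuousWithinAt_update_same.2 (hc.mono_left (nhdsWithin_mono _ ?_)))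
      exact fun z hz => lt_of_le_of_ne hz.1.1 (Ne.symm hz.2)
    · exact ((hf y hy0).continuousAt.congr (hF y hy0).symm).continuousWithinAt
  have hd : ∀ y ∈ Ioo 0 x, HasDerivAt F (deriv f y) y := fun y hy =>
    (hf y hy.1).hasDerivAt.congr_of_eventuallyEq (hF y hy.1)
  have hint : IntegrableOn (deriv f) (Ioc 0 x) :=
    intervalIntegral.integrableOn_deriv_of_nonneg hcont hd fun y hy => hf' y hy.1
  have hnn : 0 ≤ᵐ[volume.restrict (Ioc 0 x)] deriv f :=
    (ae_restrict_iff' measurableSet_Ioc).2 (ae_of_all _ fun y hy => hf' y hy.1)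
  have hFTC := intervalIntegral.integral_eq_sub_of_hasDerivAt_of_le hx.le hcont hd
    ((intervalIntegrable_iff_integrableOn_Ioc_of_le hx.le).2 hint)
  rw [intervalIntegral.integral_of_le hx.le, show F x = f x from Function.update_of_ne hx.ne' _ _,
    show F 0 = c from Function.update_self _ _ _] at hFTC
  rw [← hFTC]
  exact ⟨integral_nonneg_of_ae hnn, ofReal_integral_eq_lintegral_ofReal hint hnn⟩

lemma isLStieltjes_rpow_mul_sub {β l c : ℝ} {f : ℝ → ℝ}
    (hf : ∀ y, 0 < y → DifferentiableAt ℝ f y)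
    (hg : IsGenStieltjes β (fun x => x ^ (1 - l) * deriv f x))
    (hc : Tendsto f (nhdsWithin 0 (Ioi 0)) (nhds c)) :
    (∀ x, 0 < x → 0 ≤ f x - c) ∧
      IsLStieltjes β (fun x => ENNReal.ofReal (x ^ (-l) * (f x - c))) := by
  have hf' : ∀ y, 0 < y → 0 ≤ deriv f y := fun y hy =>
    nonneg_of_mul_nonneg_right (hg.nonneg hy) (rpow_pos_of_pos hy _)
  refine ⟨fun x hx => (sub_eq_lintegral_of_tendsto hx hf hf' hc).1,
    (hg.isLStieltjes.lintegral_comp_mul (l := l)).congr fun x hx => ?_⟩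
  rw [ENNReal.ofReal_mul (by positivity), (sub_eq_lintegral_of_tendsto hx hf hf' hc).2,
    ← lintegral_indicator measurableSet_Ioc, ← lintegral_indicator measurableSet_Ioc,
    lintegral_comp_mul_left_real hx (Measurable.indicator
      (measurable_deriv f).ennreal_ofReal measurableSet_Ioc), ← mul_assoc,
    ← ENNReal.ofReal_mul (by positivity), ← lintegral_const_mul' _ _ ENNReal.ofReal_ne_top]
  refine lintegral_congr fun u => ?_
  by_cases hu : u ∈ Ioc (0 : ℝ) 1
  · have hu0 : 0 < u := hu.1
    rw [indicator_of_mem hu, indicator_of_mem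
        (show x * u ∈ Ioc 0 x from ⟨by positivity, mul_le_of_le_one_right hx.le hu.2⟩),
      ← ENNReal.ofReal_mul (by positivity), ← ENNReal.ofReal_mul (by positivity), ← mul_assoc]
    congr 2
    rw [mul_rpow hx.le hu0.le, mul_left_comm, ← rpow_add hu0, ← rpow_add_one hx.ne']
    ring_nf
    simp
  · rw [indicator_of_notMem hu, indicator_of_notMem, mul_zero]
    rintro ⟨h1, h2⟩
    exact hu ⟨(mul_pos_iff_of_pos_left hx).1 h1, (mul_le_iff_le_one_right hx).1 h2⟩

theorem product_of_thorinBernstein (lam₁ lam₂ α₁ α₂ : ℝ)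
    (hl₁ : 0 < lam₁) (hl₂ : 0 < lam₂) (hα₁ : α₁ < lam₁ + 1) (hα₂ : α₂ < lam₂ + 1)
    (f₁ f₂ : ℝ → ℝ)
    (hf₁smooth : ContDiffOn ℝ (⊤ : ℕ∞) f₁ (Set.Ioi 0)) (hf₁pos : ∀ x : ℝ, 0 < x → 0 < f₁ x)
    (hf₁ : IsGenStieltjes (lam₁ + 1 - α₁) (fun x => x ^ (1 - lam₁) * deriv f₁ x))
    (hf₂smooth : ContDiffOn ℝ (⊤ : ℕ∞) f₂ (Set.Ioi 0)) (hf₂pos : ∀ x : ℝ, 0 < x → 0 < f₂ x)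
    (hf₂ : IsGenStieltjes (lam₂ + 1 - α₂) (fun x => x ^ (1 - lam₂) * deriv f₂ x))
    (c₁ c₂ : ℝ)
    (hc₁ : Filter.Tendsto f₁ (nhdsWithin 0 (Set.Ioi 0)) (nhds c₁))
    (hc₂ : Filter.Tendsto f₂ (nhdsWithin 0 (Set.Ioi 0)) (nhds c₂)) :
    IsGenStieltjes (lam₁ + lam₂ + 2 - α₁ - α₂)
      (fun x => x ^ (1 - lam₁ - lam₂) * deriv (fun y => (f₁ y - c₁) * (f₂ y - c₂)) x) := by
  have hd₁ : ∀ y, 0 < y → DifferentiableAt ℝ f₁ y := fun y hy =>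
    (hf₁smooth.contDiffAt (Ioi_mem_nhds hy)).differentiableAt (by simp)
  have hd₂ : ∀ y, 0 < y → DifferentiableAt ℝ f₂ y := fun y hy =>
    (hf₂smooth.contDiffAt (Ioi_mem_nhds hy)).differentiableAt (by simp)
  obtain ⟨hn₁, hS₁⟩ := isLStieltjes_rpow_mul_sub hd₁ hf₁ hc₁
  obtain ⟨hn₂, hS₂⟩ := isLStieltjes_rpow_mul_sub hd₂ hf₂ hc₂
  have hb₁ : 0 < lam₁ + 1 - α₁ := by linarith
  have hb₂ : 0 < lam₂ + 1 - α₂ := by linarith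
  have key : ∀ x, 0 < x →
      x ^ (1 - lam₁ - lam₂) * deriv (fun y => (f₁ y - c₁) * (f₂ y - c₂)) x =
        (x ^ (1 - lam₁) * deriv f₁ x) * (x ^ (-lam₂) * (f₂ x - c₂)) +
        (x ^ (-lam₁) * (f₁ x - c₁)) * (x ^ (1 - lam₂) * deriv f₂ x) := by
    intro x hx
    rw [(((hd₁ x hx).hasDerivAt.sub_const c₁).fun_mul
      ((hd₂ x hx).hasDerivAt.sub_const c₂)).deriv]
    have h1 : x ^ (1 - lam₁ - lam₂) = x ^ (1 - lam₁) * x ^ (-lam₂) := by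
      rw [← rpow_add hx]; ring_nf
    have h2 : x ^ (1 - lam₁ - lam₂) = x ^ (-lam₁) * x ^ (1 - lam₂) := by
      rw [← rpow_add hx]; ring_nf
    rw [mul_add, ← mul_assoc, ← mul_assoc]
    nth_rewrite 1 [h1]
    rw [h2]
    ring
  have hsum := (hf₁.isLStieltjes.mul hb₁ hb₂ hS₂).add (hS₁.mul hb₁ hb₂ hf₂.isLStieltjes)
  rw [show lam₁ + 1 - α₁ + (lam₂ + 1 - α₂) = lam₁ + lam₂ + 2 - α₁ - α₂ by ring] at hsum
  have hterms : ∀ x, 0 < x →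
      0 ≤ (x ^ (1 - lam₁) * deriv f₁ x) * (x ^ (-lam₂) * (f₂ x - c₂)) ∧
      0 ≤ (x ^ (-lam₁) * (f₁ x - c₁)) * (x ^ (1 - lam₂) * deriv f₂ x) := fun x hx =>
    ⟨mul_nonneg (hf₁.nonneg hx) (mul_nonneg (by positivity) (hn₂ x hx)),
      mul_nonneg (mul_nonneg (by positivity) (hn₁ x hx)) (hf₂.nonneg hx)⟩
  refine IsLStieltjes.isGenStieltjes (fun x hx => ?_) (hsum.congr fun x hx => ?_)
  · rw [key x hx]
    exact add_nonneg (hterms x hx).1 (hterms x hx).2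
  · rw [key x hx, ENNReal.ofReal_add (hterms x hx).1 (hterms x hx).2,
      ENNReal.ofReal_mul (hf₁.nonneg hx),
      ENNReal.ofReal_mul (mul_nonneg (by positivity) (hn₁ x hx))]
end

section
/- Let 0 < b < a and define f(x) = ∫₀^x e^{-bt}(1-e^{-t})^{a-b-1} dt for x > 0 (equal to B(b, a-b) - B(b, a-b, e^{-x}), the complement of the incomplete Beta function). Then f belongs to the generalized Bernstein class B_{⌊a-b⌋+1}, i.e. the function x ↦ x^{-⌊a-b⌋} e^{-bx}(1-e^{-x})^{a-b-1} is completely monotonic on (0,∞), where ⌊·⌋ denotes the integer part. -/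
open MeasureTheory Real Set

open scoped ContDiff

/-- The derivatives of `f` on `(0,∞)` up to order `N` alternate in sign. -/
def AlternatingUpTo (N : ℕ) (f : ℝ → ℝ) : Prop :=
  ∀ k ≤ N, ∀ x : ℝ, 0 < x → 0 ≤ (-1 : ℝ) ^ k * iteratedDeriv k f x

theorem AlternatingUpTo.mul {N : ℕ} {f g : ℝ → ℝ} (hf : AlternatingUpTo N f)
    (hg : AlternatingUpTo N g) (hfs : ContDiffOn ℝ ∞ f (Ioi 0))
    (hgs : ContDiffOn ℝ ∞ g (Ioi 0)) : AlternatingUpTo N (f * g) := by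
  intro k hk x hx
  have hn : (k : WithTop ℕ∞) ≤ ∞ := by exact_mod_cast le_top
  have hfx : ContDiffAt ℝ k f x := (hfs.contDiffAt (Ioi_mem_nhds hx)).of_le hn
  have hgx : ContDiffAt ℝ k g x := (hgs.contDiffAt (Ioi_mem_nhds hx)).of_le hn
  rw [iteratedDeriv_mul hfx hgx, Finset.mul_sum]
  refine Finset.sum_nonneg fun i hi => ?_
  have hik : i ≤ k := Nat.lt_succ_iff.mp (Finset.mem_range.mp hi)
  have h₁ := hf i (hik.trans hk) x hx
  have h₂ := hg (k - i) ((Nat.sub_le k i).trans hk) x hx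
  have hpow : (-1 : ℝ) ^ k = (-1) ^ i * (-1) ^ (k - i) := by
    rw [← pow_add, Nat.add_sub_cancel' hik]
  calc (0 : ℝ) ≤ k.choose i * (((-1) ^ i * iteratedDeriv i f x) *
        ((-1) ^ (k - i) * iteratedDeriv (k - i) g x)) := by positivity
    _ = _ := by rw [hpow]; ring

theorem CompletelyMonotonicOn.alternatingUpTo {f : ℝ → ℝ} (hf : CompletelyMonotonicOn f)
    (N : ℕ) : AlternatingUpTo N f :=
  fun k _ x hx => hf.2 k x hx

theorem CompletelyMonotonicOn.mul {f g : ℝ → ℝ} (hf : CompletelyMonotonicOn f)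
    (hg : CompletelyMonotonicOn g) : CompletelyMonotonicOn (f * g) :=
  ⟨hf.1.mul hg.1, fun n x hx =>
    (hf.alternatingUpTo n).mul (hg.alternatingUpTo n) hf.1 hg.1 n le_rfl x hx⟩

theorem CompletelyMonotonicOn.congr {f g : ℝ → ℝ} (hf : CompletelyMonotonicOn f)
    (hfg : EqOn g f (Ioi 0)) : CompletelyMonotonicOn g :=
  ⟨hf.1.congr hfg, fun n x hx => by
    rw [hfg.iteratedDeriv_of_isOpen isOpen_Ioi n hx]
    exact hf.2 n x hx⟩

theorem completelyMonotonicOn_one : CompletelyMonotonicOn 1 := by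
  refine ⟨contDiffOn_const, fun n x _ => ?_⟩
  rw [show (1 : ℝ → ℝ) = fun _ => 1 from rfl, iteratedDeriv_const]
  split_ifs with h <;> simp [h]

theorem CompletelyMonotonicOn.pow {f : ℝ → ℝ} (hf : CompletelyMonotonicOn f) (n : ℕ) :
    CompletelyMonotonicOn (f ^ n) := by
  induction n with
  | zero => simpa using completelyMonotonicOn_one
  | succ n ih => rw [pow_succ]; exact ih.mul hf

theorem completelyMonotonicOn_exp_neg_mul {b : ℝ} (hb : 0 ≤ b) :
    CompletelyMonotonicOn (fun x => exp (-b * x)) := by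
  refine ⟨by fun_prop, fun n x _ => ?_⟩
  rw [iteratedDeriv_exp_const_mul, ← mul_assoc, ← mul_pow]
  simp only [neg_mul, one_mul, neg_neg]
  positivity

theorem completelyMonotonicOn_of_hasDerivAt {f : ℝ → ℝ} (hf : ContDiffOn ℝ ∞ f (Ioi 0))
    (u : ℕ → ℝ → ℝ) (hfu : EqOn f (u 0) (Ioi 0))
    (hu : ∀ n x, 0 < x → HasDerivAt (u n) (-u (n + 1) x) x)
    (hpos : ∀ n x, 0 < x → 0 ≤ u n x) : CompletelyMonotonicOn f := by
  refine ⟨hf, fun n x hx => ?_⟩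
  have key : EqOn (iteratedDeriv n f) (fun y => (-1) ^ n * u n y) (Ioi 0) := by
    induction n with
    | zero => intro y hy; simpa using hfu hy
    | succ n ih =>
      intro y hy
      rw [iteratedDeriv_succ, (ih.eventuallyEq_of_mem (Ioi_mem_nhds hy)).deriv_eq,
        ((hu n y hy).const_mul _).deriv, pow_succ]
      ring
  rw [key hx, ← mul_assoc, ← mul_pow]
  simpa using hpos n x hx

theorem hasDerivAt_exp_neg_mul_sum (n : ℕ) (x : ℝ) :
    HasDerivAt (fun y : ℝ => exp (-y) * ∑ k ∈ Finset.range (n + 1), y ^ k / k.factorial)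
      (-(exp (-x) * (x ^ n / n.factorial))) x := by
  have hexp : HasDerivAt (fun y : ℝ => exp (-y)) (-exp (-x)) x := by
    simpa using (hasDerivAt_neg x).exp
  induction n with
  | zero => simpa using hexp
  | succ n ih =>
    have hlast : HasDerivAt (fun y : ℝ => y ^ (n + 1) / (n + 1).factorial)
        (x ^ n / n.factorial) x := by
      refine ((hasDerivAt_pow (n + 1) x).div_const _).congr_deriv ?_
      have := Nat.factorial_pos n
      rw [Nat.factorial_succ]
      push_cast
      field_simp
    have h := ih.add (hexp.mul hlast)
    refine (h.congr_of_eventuallyEq (.of_forall fun y => ?_)).congr_deriv ?_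
    · simp only [Pi.add_apply, Pi.mul_apply]
      rw [Finset.sum_range_succ _ (n + 1), mul_add]
    · ring

theorem completelyMonotonicOn_one_sub_exp_neg_div :
    CompletelyMonotonicOn (fun x => (1 - exp (-x)) / x) := by
  refine completelyMonotonicOn_of_hasDerivAt ?_ (fun n x => n.factorial / x ^ (n + 1) *
    (1 - exp (-x) * ∑ k ∈ Finset.range (n + 1), x ^ k / k.factorial)) ?_ ?_ ?_
  · exact ContDiffOn.div (by fun_prop) contDiffOn_id fun x hx => ne_of_gt hx
  · intro x _
    simp [div_eq_inv_mul]
  · intro n x hx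
    have hx0 := hx.ne'
    have h₁ : HasDerivAt (fun y : ℝ => (n.factorial : ℝ) / y ^ (n + 1))
        (-((n + 1).factorial / x ^ (n + 2))) x := by
      refine ((hasDerivAt_const x (n.factorial : ℝ)).div (hasDerivAt_pow (n + 1) x)
        (pow_ne_zero _ hx0)).congr_deriv ?_
      rw [Nat.factorial_succ]
      push_cast
      field_simp
      ring
    refine (h₁.mul ((hasDerivAt_exp_neg_mul_sum n x).const_sub 1)).congr_deriv ?_
    rw [Finset.sum_range_succ _ (n + 1)]
    generalize ∑ k ∈ Finset.range (n + 1), x ^ k / (k.factorial : ℝ) = S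
    have := Nat.factorial_pos n
    rw [Nat.factorial_succ]
    push_cast
    field_simp
    ring
  · intro n x hx
    have h := Real.sum_le_exp_of_nonneg hx.le (n + 1)
    have h' : exp (-x) * ∑ k ∈ Finset.range (n + 1), x ^ k / (k.factorial : ℝ) ≤ 1 := by
      calc _ ≤ exp (-x) * exp x := by gcongr
        _ = 1 := by rw [← exp_add]; simp
    have := sub_nonneg.2 h'
    positivity

theorem one_sub_exp_neg_pos_s14 {x : ℝ} (hx : 0 < x) : 0 < 1 - exp (-x) := by
  simpa using hx

theorem contDiffOn_one_sub_exp_neg_rpow (c : ℝ) :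
    ContDiffOn ℝ ∞ (fun x => (1 - exp (-x)) ^ c) (Ioi 0) :=
  ContDiffOn.rpow_const_of_ne (by fun_prop) fun _ hx => (one_sub_exp_neg_pos_s14 hx).ne'

theorem hasDerivAt_one_sub_exp_neg_rpow (c : ℝ) {x : ℝ} (hx : 0 < x) :
    HasDerivAt (fun y => (1 - exp (-y)) ^ c) (c * (exp (-x) * (1 - exp (-x)) ^ (c - 1))) x := by
  have h : HasDerivAt (fun y : ℝ => 1 - exp (-y)) (exp (-x)) x := by
    simpa using (hasDerivAt_neg x).exp.const_sub 1
  refine (h.rpow_const (p := c) (Or.inl (one_sub_exp_neg_pos_s14 hx).ne')).congr_deriv ?_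
  ring

theorem alternatingUpTo_one_sub_exp_neg_rpow (N : ℕ) :
    ∀ c : ℝ, c ≤ 0 → AlternatingUpTo N (fun x => (1 - exp (-x)) ^ c) := by
  induction N with
  | zero =>
    intro c _ k hk x hx
    obtain rfl := Nat.le_zero.mp hk
    simpa using rpow_nonneg (one_sub_exp_neg_pos_s14 hx).le c
  | succ N ih =>
    intro c hc k hk x hx
    cases k with
    | zero => simpa using rpow_nonneg (one_sub_exp_neg_pos_s14 hx).le c
    | succ j =>
      have hexp := completelyMonotonicOn_exp_neg_mul zero_le_one
      have h := (hexp.alternatingUpTo N).mul (ih (c - 1) (by linarith)) hexp.1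
        (contDiffOn_one_sub_exp_neg_rpow (c - 1)) j (by omega) x hx
      have hd : EqOn (deriv fun y => (1 - exp (-y)) ^ c)
          (fun y => c * ((fun z => exp (-1 * z)) * fun z => (1 - exp (-z)) ^ (c - 1)) y)
          (Ioi 0) := fun y hy => by
        simpa using (hasDerivAt_one_sub_exp_neg_rpow c hy).deriv
      rw [iteratedDeriv_succ', hd.iteratedDeriv_of_isOpen isOpen_Ioi j hx,
        iteratedDeriv_const_mul_field]
      have := mul_nonneg (neg_nonneg.2 hc) h
      rw [pow_succ]
      linarith

theorem completelyMonotonicOn_one_sub_exp_neg_rpow {c : ℝ} (hc : c ≤ 0) :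
    CompletelyMonotonicOn (fun x => (1 - exp (-x)) ^ c) :=
  ⟨contDiffOn_one_sub_exp_neg_rpow c, fun n x hx =>
    alternatingUpTo_one_sub_exp_neg_rpow n c hc n le_rfl x hx⟩

theorem intervalIntegrable_exp_mul_one_sub_exp_neg_rpow (b : ℝ) {c x : ℝ} (hc : 0 < c)
    (hx : 0 ≤ x) :
    IntervalIntegrable (fun t => exp (-b * t) * (1 - exp (-t)) ^ (c - 1)) volume 0 x := by
  have h : IntervalIntegrable (fun t => c * (exp (-t) * (1 - exp (-t)) ^ (c - 1)))
      volume 0 x := by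
    refine intervalIntegral.intervalIntegrable_deriv_of_nonneg
      (g := fun t => (1 - exp (-t)) ^ c) ?_ ?_ ?_
    · exact (Continuous.rpow_const (by fun_prop) fun _ => Or.inr hc.le).continuousOn
    · intro t ht
      rw [min_eq_left hx] at ht
      exact hasDerivAt_one_sub_exp_neg_rpow c ht.1
    · intro t ht
      rw [min_eq_left hx] at ht
      have := (one_sub_exp_neg_pos_s14 ht.1).le
      positivity
  have h' := h.continuousOn_mul
    (g := fun t => c⁻¹ * exp ((1 - b) * t)) (by fun_prop)
  refine h'.congr fun t _ => ?_
  have he : exp (-b * t) = exp ((1 - b) * t) * exp (-t) := by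
    rw [← exp_add]; ring_nf
  simp only [he]
  field_simp

theorem hasDerivAt_integral_exp_mul_one_sub_exp_neg_rpow (b : ℝ) {c x : ℝ} (hc : 0 < c)
    (hx : 0 < x) :
    HasDerivAt (fun y => ∫ t in (0 : ℝ)..y, exp (-b * t) * (1 - exp (-t)) ^ (c - 1))
      (exp (-b * x) * (1 - exp (-x)) ^ (c - 1)) x := by
  have hcont : ContinuousOn (fun t => exp (-b * t) * (1 - exp (-t)) ^ (c - 1)) (Ioi 0) :=
    ContinuousOn.mul (by fun_prop) (contDiffOn_one_sub_exp_neg_rpow (c - 1)).continuousOn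
  exact intervalIntegral.integral_hasDerivAt_right
    (intervalIntegrable_exp_mul_one_sub_exp_neg_rpow b hc hx.le)
    (hcont.stronglyMeasurableAtFilter isOpen_Ioi x hx)
    (hcont.continuousAt (Ioi_mem_nhds hx))

/-- The complement of the incomplete Beta function,
`f(x) = B(b,a-b) - B(b,a-b,e^{-x}) = ∫₀ˣ e^{-bt}(1-e^{-t})^{a-b-1} dt`, belongs to
`B_{⌊a-b⌋+1}`, i.e. `x^{-⌊a-b⌋} e^{-bx}(1-e^{-x})^{a-b-1}` is completely monotonic. -/
theorem incompleteBeta_complement_mem_genBernstein (a b : ℝ) (hb : 0 < b) (hba : b < a)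
    (f : ℝ → ℝ)
    (hf : ∀ x : ℝ, f x = ∫ t in (0:ℝ)..x, Real.exp (-b * t) * (1 - Real.exp (-t)) ^ (a - b - 1)) :
    CompletelyMonotonicOn (fun x => x ^ (1 - ((⌊a - b⌋ : ℝ) + 1)) * deriv f x) ∧
    CompletelyMonotonicOn
      (fun x => x ^ (-(⌊a - b⌋ : ℝ)) * (Real.exp (-b * x) * (1 - Real.exp (-x)) ^ (a - b - 1))) := by
  have hab : 0 < a - b := sub_pos.2 hba
  have hmain : CompletelyMonotonicOn
      (fun x => x ^ (-(⌊a - b⌋ : ℝ)) * (exp (-b * x) * (1 - exp (-x)) ^ (a - b - 1))) := by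
    obtain ⟨n, hn⟩ := Int.eq_ofNat_of_zero_le (Int.floor_nonneg.2 hab.le)
    have hlt : a - b - n - 1 ≤ 0 := by
      have := Int.lt_floor_add_one (a - b)
      rw [hn] at this
      push_cast at this
      linarith
    refine (((completelyMonotonicOn_exp_neg_mul hb.le).mul
      (completelyMonotonicOn_one_sub_exp_neg_div.pow n)).mul
      (completelyMonotonicOn_one_sub_exp_neg_rpow hlt)).congr fun x hx => ?_
    have hx' : 0 < x := hx
    have hpow : (1 - exp (-x)) ^ (a - b - 1) =
        (1 - exp (-x)) ^ n * (1 - exp (-x)) ^ (a - b - n - 1) := by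
      rw [← rpow_natCast, ← rpow_add (one_sub_exp_neg_pos_s14 hx')]
      ring_nf
    simp only [Pi.mul_apply, Pi.pow_apply, hn, Int.cast_natCast]
    rw [hpow, rpow_neg hx'.le, rpow_natCast, div_pow]
    field_simp
  refine ⟨hmain.congr fun x hx => ?_, hmain⟩
  have hd := hasDerivAt_integral_exp_mul_one_sub_exp_neg_rpow b hab hx
  rw [← funext hf] at hd
  simp only [hd.deriv]
  ring_nf
end
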